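/- Corollary 3.4: For x_n, x_0 ∈ D([0,T]), x_n ⇒*_S x_0 if and only if x_n(T) → x_0(T) and, for every relatively τ-compact set 𝒜 ⊆ 𝔸, sup_{A ∈ 𝒜} | ∫_0^T (x_n(u) − x_0(u)) dA(u) | → 0 as n → ∞. -/

import Mathlib

open MeasureTheory Filter Set Topology

noncomputable section

/-- `x` is càdlàg on `[0,T]`: right-continuous at every `t ∈ [0,T)` and
admitting a left limit at every `t ∈ (0,T]`. -/
def Cadlag (T : ℝ) (x : ℝ → ℝ) : Prop :=
  (∀ t ∈ Set.Ico (0:ℝ) T, Filter.Tendsto x (nhdsWithin t (Set.Ioi t)) (nhds (x t))) ∧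
  (∀ t ∈ Set.Ioc (0:ℝ) T, ∃ L : ℝ, Filter.Tendsto x (nhdsWithin t (Set.Iio t)) (nhds L))

/-- membership in `𝕍`: càdlàg of finite total variation on `[0,T]`. -/
def MemV (T : ℝ) (v : ℝ → ℝ) : Prop :=
  Cadlag T v ∧ BoundedVariationOn v (Set.Icc 0 T)

/-- `μ` is the finite signed (Lebesgue–Stieltjes) measure induced by `v` on `[0,T]`:
`μ([0,t]) = v(t)` for `t ∈ [0,T]`, and `μ` vanishes outside `[0,T]`. -/
def Represents (T : ℝ) (μ : MeasureTheory.SignedMeasure ℝ) (v : ℝ → ℝ) : Prop :=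
  (∀ t ∈ Set.Icc (0:ℝ) T, μ (Set.Icc 0 t) = v t) ∧
  (∀ s : Set ℝ, MeasurableSet s → s ∩ Set.Icc (0:ℝ) T = ∅ → μ s = 0)

/-- Integral of `f` against a signed measure. -/
noncomputable def sInt (μ : MeasureTheory.SignedMeasure ℝ) (f : ℝ → ℝ) : ℝ :=
  (∫ t, f t ∂μ.toJordanDecomposition.posPart) - (∫ t, f t ∂μ.toJordanDecomposition.negPart)

/-- `∫_{[0,T]} f dv` : integral of `f` with respect to the Lebesgue–Stieltjes
signed measure induced by `v` on `[0,T]`. -/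
noncomputable def intD (T : ℝ) (f v : ℝ → ℝ) : ℝ :=
  letI := Classical.propDecidable (∃ μ : MeasureTheory.SignedMeasure ℝ, Represents T μ v)
  if h : ∃ μ : MeasureTheory.SignedMeasure ℝ, Represents T μ v then sInt h.choose f else 0

/-- S-convergence `x_n →_S x₀` on `D([0,T])`. -/
def SConv (T : ℝ) (x : ℕ → ℝ → ℝ) (x₀ : ℝ → ℝ) : Prop :=
  ∀ ε > (0:ℝ), ∃ v : ℕ → ℝ → ℝ, ∃ v₀ : ℝ → ℝ,
    (∀ n, MemV T (v n)) ∧ MemV T v₀ ∧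
    (∀ n, ∀ t ∈ Set.Icc (0:ℝ) T, |x n t - v n t| ≤ ε) ∧
    (∀ t ∈ Set.Icc (0:ℝ) T, |x₀ t - v₀ t| ≤ ε) ∧
    (∀ f : ℝ → ℝ, Continuous f →
      Filter.Tendsto (fun n => intD T f (v n)) Filter.atTop (nhds (intD T f v₀)))

/-- `x_n ⇒*_S x₀` : every subsequence contains a further subsequence `→_S`-converging to `x₀`. -/
def SStarConv (T : ℝ) (x : ℕ → ℝ → ℝ) (x₀ : ℝ → ℝ) : Prop :=
  ∀ φ : ℕ → ℕ, StrictMono φ →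
    ∃ ψ : ℕ → ℕ, StrictMono ψ ∧ SConv T (fun k => x (φ (ψ k))) x₀

/-- membership in `𝔸([0,T])`: continuous, of finite variation, vanishing at `0`. -/
def MemA (T : ℝ) (A : ℝ → ℝ) : Prop :=
  ContinuousOn A (Set.Icc 0 T) ∧ BoundedVariationOn A (Set.Icc 0 T) ∧ A 0 = 0

/-- `A_n →_τ A₀` : uniform convergence on `[0,T]` together with uniformly bounded
total variations. -/
def TauConv (T : ℝ) (A : ℕ → ℝ → ℝ) (A₀ : ℝ → ℝ) : Prop :=
  TendstoUniformlyOn (fun n => A n) A₀ Filter.atTop (Set.Icc 0 T) ∧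
  ∃ M : ℝ, ∀ n, eVariationOn (A n) (Set.Icc 0 T) ≤ ENNReal.ofReal M

/-- `x` has (at least) `k` up-crossings of the levels `a < b` on `[0,T]`. -/
def HasUpcrossings (T a b : ℝ) (x : ℝ → ℝ) (k : ℕ) : Prop :=
  ∃ s u : Fin k → ℝ, (∀ i, 0 ≤ s i ∧ s i < u i ∧ u i ≤ T) ∧
    (∀ i j : Fin k, i < j → u i < s j) ∧
    (∀ i, x (s i) < a ∧ b < x (u i))

/-- `x` has (at least) `k` `η`-oscillations on `[0,T]`. -/
def HasOscillations (T η : ℝ) (x : ℝ → ℝ) (k : ℕ) : Prop :=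
  ∃ s u : Fin k → ℝ, (∀ i, 0 ≤ s i ∧ s i < u i ∧ u i ≤ T) ∧
    (∀ i j : Fin k, i < j → u i ≤ s j) ∧
    (∀ i, |x (u i) - x (s i)| > η)


/-- `𝒜 ⊆ 𝔸([0,T])` is relatively `τ`-compact: every sequence in `𝒜` has a
`→_τ`-convergent subsequence with limit in `𝔸([0,T])`. -/
def RelTauCompact (T : ℝ) (𝒜 : Set (ℝ → ℝ)) : Prop :=
  ∀ A : ℕ → ℝ → ℝ, (∀ n, A n ∈ 𝒜) →
    ∃ φ : ℕ → ℕ, StrictMono φ ∧ ∃ A₀ : ℝ → ℝ, MemA T A₀ ∧ TauConv T (fun k => A (φ k)) A₀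

/-- `P - N` is the signed measure on `[0,T]` with distribution function `v`. -/
structure IsDecomp (T : ℝ) (v : ℝ → ℝ) (P N : Measure ℝ) : Prop where
  finP : IsFiniteMeasure P
  finN : IsFiniteMeasure N
  suppP : P (Icc 0 T)ᶜ = 0
  suppN : N (Icc 0 T)ᶜ = 0
  sub : ∀ t ∈ Icc (0:ℝ) T, P.real (Iic t) - N.real (Iic t) = v t

/-- `f` is Borel measurable and bounded on `[0,T]`. -/
def BddMeas (T : ℝ) (f : ℝ → ℝ) : Prop :=
  Measurable (indicator (Icc 0 T) f) ∧ ∃ C, ∀ t ∈ Icc (0:ℝ) T, |f t| ≤ C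

lemma ae_mem_Icc {T : ℝ} {P : Measure ℝ} (h : P (Icc 0 T)ᶜ = 0) : ∀ᵐ t ∂P, t ∈ Icc (0:ℝ) T := by
  rw [ae_iff]
  exact h

lemma BddMeas.integrable {T : ℝ} {f : ℝ → ℝ} (hf : BddMeas T f) {P : Measure ℝ}
    [IsFiniteMeasure P] (h : P (Icc 0 T)ᶜ = 0) : Integrable f P := by
  obtain ⟨hm, C, hC⟩ := hf
  refine Integrable.of_bound (C := C) ?_ ?_
  · refine ⟨_, hm.stronglyMeasurable, ?_⟩
    filter_upwards [ae_mem_Icc h] with t ht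
    simp [indicator_of_mem ht]
  · filter_upwards [ae_mem_Icc h] with t ht using hC t ht

lemma BddMeas.sub {T : ℝ} {f g : ℝ → ℝ} (hf : BddMeas T f) (hg : BddMeas T g) :
    BddMeas T (fun t => f t - g t) := by
  obtain ⟨hm, C, hC⟩ := hf
  obtain ⟨hm', C', hC'⟩ := hg
  refine ⟨?_, C + C', fun t ht => (abs_sub _ _).trans (add_le_add (hC t ht) (hC' t ht))⟩
  convert hm.sub hm' using 1
  exact indicator_sub _ _ _

lemma ContinuousOn.bddMeas {T : ℝ} {f : ℝ → ℝ} (hf : ContinuousOn f (Icc 0 T)) :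
    BddMeas T f := by
  obtain ⟨C, hC⟩ := isCompact_Icc.exists_bound_of_continuousOn hf
  refine ⟨?_, C, hC⟩
  classical
  rw [← piecewise_eq_indicator]
  exact hf.measurable_piecewise continuousOn_const measurableSet_Icc

/-- A signed measure representing `v` is determined on left half-lines. -/
lemma Represents.apply_Iic {T : ℝ} (hT : 0 < T) {μ : SignedMeasure ℝ} {v : ℝ → ℝ}
    (h : Represents T μ v) (a : ℝ) : μ (Iic a) = if a < 0 then 0 else v (min a T) := by
  split_ifs with ha
  · refine h.2 _ measurableSet_Iic ?_
    ext t
    simp only [mem_inter_iff, mem_Iic, mem_Icc, mem_empty_iff_false, iff_false]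
    intro ht
    linarith [ht.1, ht.2.1]
  · have h1 : Iic a = Icc 0 (min a T) ∪ (Iic a \ Icc 0 T) := by
      ext t
      simp only [mem_Iic, mem_union, mem_Icc, le_min_iff, Set.mem_sdiff]
      tauto
    rw [h1, VectorMeasure.of_union _ measurableSet_Icc (measurableSet_Iic.diff measurableSet_Icc),
      h.1 _ ⟨le_min (not_lt.1 ha) hT.le, min_le_right _ _⟩,
      h.2 _ (measurableSet_Iic.diff measurableSet_Icc) (by ext; simp), add_zero]
    rw [disjoint_left]
    rintro t ⟨h2, h3⟩ ⟨-, h4⟩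
    exact h4 ⟨h2, h3.trans (min_le_right _ _)⟩

lemma Represents.unique {T : ℝ} (hT : 0 < T) {μ ν : SignedMeasure ℝ} {v : ℝ → ℝ}
    (h : Represents T μ v) (h' : Represents T ν v) : μ = ν := by
  set p := μ.toJordanDecomposition with hp
  set q := ν.toJordanDecomposition with hq
  have key : p.posPart + q.negPart = q.posPart + p.negPart := by
    refine Measure.ext_of_Iic _ _ fun a => ?_
    have h1 := (h.apply_Iic hT a).trans (h'.apply_Iic hT a).symm
    rw [μ.apply_eq_posPart_real_sub_negPart_real measurableSet_Iic,
      ν.apply_eq_posPart_real_sub_negPart_real measurableSet_Iic] at h1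
    rw [← measureReal_eq_measureReal_iff]
    rw [measureReal_add_apply, measureReal_add_apply]
    linarith
  ext s hs
  rw [μ.apply_eq_posPart_real_sub_negPart_real hs, ν.apply_eq_posPart_real_sub_negPart_real hs]
  have : (p.posPart + q.negPart).real s = (q.posPart + p.negPart).real s := by rw [key]
  rw [measureReal_add_apply, measureReal_add_apply] at this
  linarith

lemma IsDecomp.represents {T : ℝ} {v : ℝ → ℝ} {P N : Measure ℝ} [IsFiniteMeasure P]
    [IsFiniteMeasure N] (h : IsDecomp T v P N) :
    Represents T (P.toSignedMeasure - N.toSignedMeasure) v := by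
  have hz : ∀ {Q : Measure ℝ}, Q (Icc 0 T)ᶜ = 0 → ∀ s : Set ℝ, s ∩ Icc (0:ℝ) T = ∅ →
      Q.real s = 0 := by
    intro Q hQ s hs
    rw [measureReal_def, measure_mono_null _ hQ, ENNReal.toReal_zero]
    rw [subset_compl_iff_disjoint_right, disjoint_iff_inter_eq_empty]
    exact hs
  refine ⟨fun t ht => ?_, fun s hs hs' => ?_⟩
  · rw [Measure.toSignedMeasure_sub_apply measurableSet_Icc, ← h.sub t ht]
    have h1 : ∀ {Q : Measure ℝ}, Q (Icc 0 T)ᶜ = 0 → Q.real (Icc 0 t) = Q.real (Iic t) := by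
      intro Q hQ
      refine measureReal_congr ?_
      filter_upwards [ae_mem_Icc hQ] with u hu
      simp only [eq_iff_iff]
      exact ⟨fun h => h.2, fun h => ⟨hu.1, h⟩⟩
    rw [h1 h.suppP, h1 h.suppN]
  · rw [Measure.toSignedMeasure_sub_apply hs, hz h.suppP s hs', hz h.suppN s hs', sub_zero]

lemma IsDecomp.intD_eq {T : ℝ} (hT : 0 < T) {v f : ℝ → ℝ} {P N : Measure ℝ}
    (h : IsDecomp T v P N) (hf : BddMeas T f) :
    intD T f v = ∫ t, f t ∂P - ∫ t, f t ∂N := by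
  have := h.finP
  have := h.finN
  have hex : ∃ μ : SignedMeasure ℝ, Represents T μ v := ⟨_, h.represents⟩
  have h1 : intD T f v = sInt hex.choose f := by
    unfold intD
    exact dif_pos hex
  rw [h1, hex.choose_spec.unique hT h.represents, sInt,
    Measure.toJordanDecomposition_toSignedMeasure_sub,
    Measure.jordanDecompositionOfToSignedMeasureSub_posPart,
    Measure.jordanDecompositionOfToSignedMeasureSub_negPart]
  have hP : Integrable f P := hf.integrable h.suppP
  have hN : Integrable f N := hf.integrable h.suppN
  have hPN : Integrable f (P - N) := hP.mono_measure Measure.sub_le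
  have hNP : Integrable f (N - P) := hN.mono_measure Measure.sub_le
  have key : P + (N - P) = N + (P - N) := by
    ext s hs
    have h2 := congrArg (fun m : SignedMeasure ℝ => m s)
      (Measure.sub_toSignedMeasure_eq_toSignedMeasure_sub (μ := P) (ν := N))
    simp only [Measure.toSignedMeasure_sub_apply hs] at h2
    rw [← measureReal_eq_measureReal_iff, measureReal_add_apply, measureReal_add_apply]
    linarith
  have h3 := congrArg (fun m : Measure ℝ => ∫ t, f t ∂m) key
  simp only [integral_add_measure hP hNP, integral_add_measure hN hPN] at h3
  linarith

lemma intD_congr {T : ℝ} (hT : 0 < T) {v f g : ℝ → ℝ} {P N : Measure ℝ} (h : IsDecomp T v P N)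
    (hf : BddMeas T f) (hg : BddMeas T g) (hfg : EqOn f g (Icc 0 T)) :
    intD T f v = intD T g v := by
  rw [h.intD_eq hT hf, h.intD_eq hT hg]
  congr 1 <;> apply integral_congr_ae
  · filter_upwards [ae_mem_Icc h.suppP] with t ht using hfg ht
  · filter_upwards [ae_mem_Icc h.suppN] with t ht using hfg ht

lemma intD_sub {T : ℝ} (hT : 0 < T) {v f g : ℝ → ℝ} {P N : Measure ℝ} (h : IsDecomp T v P N)
    (hf : BddMeas T f) (hg : BddMeas T g) :
    intD T (fun t => f t - g t) v = intD T f v - intD T g v := by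
  have := h.finP
  have := h.finN
  rw [h.intD_eq hT (hf.sub hg), h.intD_eq hT hf, h.intD_eq hT hg,
    integral_sub (hf.integrable h.suppP) (hg.integrable h.suppP),
    integral_sub (hf.integrable h.suppN) (hg.integrable h.suppN)]
  ring

lemma IsDecomp.abs_intD_le {T : ℝ} (hT : 0 < T) {v f : ℝ → ℝ} {P N : Measure ℝ}
    (h : IsDecomp T v P N) (hf : BddMeas T f) {C : ℝ} (hC : ∀ t ∈ Icc (0:ℝ) T, |f t| ≤ C) :
    |intD T f v| ≤ C * (P.real univ + N.real univ) := by
  have := h.finP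
  have := h.finN
  rw [h.intD_eq hT hf]
  have h1 : ‖∫ t, f t ∂P‖ ≤ C * P.real univ := norm_integral_le_of_norm_le_const (by
    filter_upwards [ae_mem_Icc h.suppP] with t ht using hC t ht)
  have h2 : ‖∫ t, f t ∂N‖ ≤ C * N.real univ := norm_integral_le_of_norm_le_const (by
    filter_upwards [ae_mem_Icc h.suppN] with t ht using hC t ht)
  calc _ ≤ _ := abs_sub _ _
    _ ≤ _ := add_le_add h1 h2
    _ = _ := by ring

lemma IsDecomp.add {T : ℝ} {v w : ℝ → ℝ} {P N P' N' : Measure ℝ}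
    (h : IsDecomp T v P N) (h' : IsDecomp T w P' N') :
    IsDecomp T (fun t => v t + w t) (P + P') (N + N') := by
  have := h.finP
  have := h.finN
  have := h'.finP
  have := h'.finN
  refine ⟨inferInstance, inferInstance, ?_, ?_, fun t ht => ?_⟩
  · simp [h.suppP, h'.suppP]
  · simp [h.suppN, h'.suppN]
  · rw [measureReal_add_apply, measureReal_add_apply, ← h.sub t ht, ← h'.sub t ht]
    ring

lemma IsDecomp.const_mul {T : ℝ} {v : ℝ → ℝ} {P N : Measure ℝ} (h : IsDecomp T v P N) (c : ℝ) :
    IsDecomp T (fun t => c * v t) (c.toNNReal • P + (-c).toNNReal • N)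
      (c.toNNReal • N + (-c).toNNReal • P) := by
  have := h.finP
  have := h.finN
  refine ⟨inferInstance, inferInstance, ?_, ?_, fun t ht => ?_⟩
  · simp [h.suppP, h.suppN]
  · simp [h.suppP, h.suppN]
  · rw [measureReal_add_apply, measureReal_add_apply, ← h.sub t ht]
    simp only [measureReal_nnreal_smul_apply]
    have : c = c.toNNReal - (-c).toNNReal := by
      rcases le_total 0 c with hc | hc <;> simp [hc]
    nth_rw 5 [this]
    ring

lemma IsDecomp.intD_add {T : ℝ} (hT : 0 < T) {f v w : ℝ → ℝ} {P N P' N' : Measure ℝ}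
    (h : IsDecomp T v P N) (h' : IsDecomp T w P' N') (hf : BddMeas T f) :
    intD T f (fun t => v t + w t) = intD T f v + intD T f w := by
  have := h.finP
  have := h.finN
  have := h'.finP
  have := h'.finN
  rw [(h.add h').intD_eq hT hf, h.intD_eq hT hf, h'.intD_eq hT hf,
    integral_add_measure (hf.integrable h.suppP) (hf.integrable h'.suppP),
    integral_add_measure (hf.integrable h.suppN) (hf.integrable h'.suppN)]
  ring

lemma IsDecomp.intD_const_mul {T : ℝ} (hT : 0 < T) {f v : ℝ → ℝ} {P N : Measure ℝ}
    (h : IsDecomp T v P N) (hf : BddMeas T f) (c : ℝ) :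
    intD T f (fun t => c * v t) = c * intD T f v := by
  have := h.finP
  have := h.finN
  have hP := hf.integrable h.suppP
  have hN := hf.integrable h.suppN
  rw [(h.const_mul c).intD_eq hT hf, h.intD_eq hT hf,
    integral_add_measure hP.smul_measure_nnreal hN.smul_measure_nnreal,
    integral_add_measure hN.smul_measure_nnreal hP.smul_measure_nnreal]
  simp only [integral_smul_nnreal_measure, NNReal.smul_def, smul_eq_mul]
  have : c = c.toNNReal - (-c).toNNReal := by
    rcases le_total 0 c with hc | hc <;> simp [hc]
  nth_rw 5 [this]
  ring

lemma isDecomp_zero (T : ℝ) : IsDecomp T (fun _ => 0) 0 0 :=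
  ⟨inferInstance, inferInstance, by simp, by simp, by simp⟩

lemma intD_zero {T : ℝ} (hT : 0 < T) {f : ℝ → ℝ} (hf : BddMeas T f) :
    intD T f (fun _ => 0) = 0 := by
  simp [(isDecomp_zero T).intD_eq hT hf]

lemma IsDecomp.sum {T : ℝ} (hT : 0 < T) {ι : Type*} (s : Finset ι) {v : ι → ℝ → ℝ}
    (h : ∀ i ∈ s, ∃ P N, IsDecomp T (v i) P N) :
    (∃ P N, IsDecomp T (fun t => ∑ i ∈ s, v i t) P N) ∧
      ∀ f, BddMeas T f → intD T f (fun t => ∑ i ∈ s, v i t) = ∑ i ∈ s, intD T f (v i) := by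
  classical
  induction s using Finset.induction_on with
  | empty => exact ⟨⟨0, 0, by simpa using isDecomp_zero T⟩, fun f hf => by simpa using intD_zero hT hf⟩
  | insert i s hi ih =>
    obtain ⟨⟨P, N, hd⟩, ih⟩ := ih fun j hj => h j (Finset.mem_insert_of_mem hj)
    obtain ⟨P', N', hd'⟩ := h i (Finset.mem_insert_self _ _)
    simp only [Finset.sum_insert hi]
    exact ⟨⟨_, _, hd'.add hd⟩, fun f hf => by rw [hd'.intD_add hT hd hf, ih f hf]⟩

lemma exists_isDecomp {T : ℝ} (hT : 0 < T) {v : ℝ → ℝ}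
    (hr : ∀ t ∈ Ico (0:ℝ) T, Tendsto v (𝓝[>] t) (𝓝 (v t)))
    (hv : BoundedVariationOn v (Icc 0 T)) :
    ∃ P N, IsDecomp T v P N ∧
      P.real univ + N.real univ ≤ |v 0| + (eVariationOn v (Icc 0 T)).toReal := by
  set π : ℝ → ℝ := fun t => max 0 (min t T) with hπ
  have hπm : Monotone π := fun a b hab => max_le_max le_rfl (min_le_min hab le_rfl)
  have hπI : ∀ t, π t ∈ Icc (0:ℝ) T := fun t =>
    ⟨le_max_left _ _, max_le hT.le (min_le_right _ _)⟩
  have hπe : ∀ t ∈ Icc (0:ℝ) T, π t = t := fun t ht => by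
    simp only [hπ]
    rw [min_eq_left ht.2, max_eq_right ht.1]
  set w : ℝ → ℝ := v ∘ π with hw
  have hwle : eVariationOn w univ ≤ eVariationOn v (Icc 0 T) :=
    eVariationOn.comp_le_of_monotoneOn v π (hπm.monotoneOn _) fun t _ => hπI t
  have hwb : BoundedVariationOn w univ := (hwle.trans_lt hv.lt_top).ne
  have hwr : ∀ t, ContinuousWithinAt w (Ici t) t := by
    intro t
    rcases lt_or_ge (π t) T with h1 | h1
    · have h2 : ContinuousWithinAt v (Ici (π t)) (π t) := by
        rw [← continuousWithinAt_Ioi_iff_Ici]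
        exact hr _ ⟨(hπI t).1, h1⟩
      refine h2.comp ?_ fun s hs => hπm hs
      exact (by fun_prop : Continuous π).continuousWithinAt
    · have h2 : ∀ s ∈ Ici t, w s = w t := by
        intro s hs
        simp only [hw, Function.comp]
        rw [le_antisymm (hπI t).2 h1, le_antisymm (hπI s).2 (h1.trans (hπm hs))]
      exact continuousWithinAt_const.congr h2 rfl
  set V := variationOnFromTo w univ 0 with hV
  have hVr : ∀ t, ContinuousWithinAt V (Ici t) t := fun t =>
    hwb.continuousWithinAt_variationOnFromTo_Ici (hwr t)
  have hp : Monotone fun t => (V t + w t) / 2 := fun a b hab => by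
    have := variationOnFromTo.add_self_monotoneOn hwb.locallyBoundedVariationOn (mem_univ 0)
      (mem_univ a) (mem_univ b) hab
    simp only [Pi.add_apply] at this
    simp only [hV]
    linarith
  have hq : Monotone fun t => (V t - w t) / 2 := fun a b hab => by
    have := variationOnFromTo.sub_self_monotoneOn hwb.locallyBoundedVariationOn (mem_univ 0)
      (mem_univ a) (mem_univ b) hab
    simp only [Pi.sub_apply] at this
    simp only [hV]
    linarith
  let p : StieltjesFunction ℝ := ⟨_, hp, fun t => ((hVr t).add (hwr t)).div_const 2⟩
  let q : StieltjesFunction ℝ := ⟨_, hq, fun t => ((hVr t).sub (hwr t)).div_const 2⟩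
  have hpa : ∀ t, p t = (V t + w t) / 2 := fun _ => rfl
  have hqa : ∀ t, q t = (V t - w t) / 2 := fun _ => rfl
  have fin : ∀ (g : StieltjesFunction ℝ) (c : NNReal), IsFiniteMeasure
      (g.measure.restrict (Ioc 0 T) + c • Measure.dirac (0:ℝ)) := by
    intro g c
    have : IsFiniteMeasure (g.measure.restrict (Ioc 0 T)) :=
      ⟨by rw [Measure.restrict_apply_univ, g.measure_Ioc]; exact ENNReal.ofReal_lt_top⟩
    infer_instance
  have supp : ∀ (g : StieltjesFunction ℝ) (c : NNReal),
      (g.measure.restrict (Ioc 0 T) + c • Measure.dirac (0:ℝ)) (Icc 0 T)ᶜ = 0 := by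
    intro g c
    have : (Icc 0 T)ᶜ ∩ Ioc 0 T = ∅ := by
      ext t
      simp only [mem_inter_iff, mem_compl_iff, mem_Icc, mem_Ioc, mem_empty_iff_false, iff_false]
      intro h
      exact h.1 ⟨h.2.1.le, h.2.2⟩
    simp [Measure.restrict_apply measurableSet_Icc.compl, this, hT.le]
  have val : ∀ (g : StieltjesFunction ℝ) (c : NNReal), ∀ t ∈ Icc (0:ℝ) T,
      (g.measure.restrict (Ioc 0 T) + c • Measure.dirac (0:ℝ)).real (Iic t)
        = g t - g 0 + c := by
    intro g c t ht
    have h1 : Iic t ∩ Ioc 0 T = Ioc 0 t := by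
      ext s
      simp only [mem_inter_iff, mem_Iic, mem_Ioc]
      exact ⟨fun h => ⟨h.2.1, h.1⟩, fun h => ⟨h.2, h.1, h.2.trans ht.2⟩⟩
    rw [measureReal_def, Measure.add_apply, Measure.restrict_apply measurableSet_Iic, h1,
      g.measure_Ioc, Measure.smul_apply, Measure.dirac_apply' _ measurableSet_Iic,
      indicator_of_mem (show (0:ℝ) ∈ Iic t from ht.1)]
    have h2 : 0 ≤ g t - g 0 := sub_nonneg.2 (g.mono ht.1)
    rw [ENNReal.toReal_add ENNReal.ofReal_ne_top (by simp), ENNReal.toReal_ofReal h2]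
    simp
  have hw0 : w 0 = v 0 := by simp only [hw, Function.comp, hπe 0 ⟨le_rfl, hT.le⟩]
  have hV0 : V 0 = 0 := variationOnFromTo.self _ _ _
  have hc : ((v 0).toNNReal : ℝ) - (-(v 0)).toNNReal = v 0 := by
    rcases le_total 0 (v 0) with h | h <;> simp [h]
  have hc' : ((v 0).toNNReal : ℝ) + (-(v 0)).toNNReal = |v 0| := by
    rcases le_total 0 (v 0) with h | h <;> simp [h, abs_of_nonneg, abs_of_nonpos]
  refine ⟨_, _, ⟨fin p (v 0).toNNReal, fin q (-(v 0)).toNNReal, supp _ _, supp _ _, ?_⟩, ?_⟩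
  · intro t ht
    rw [val p _ t ht, val q _ t ht, hpa, hqa, hpa, hqa]
    have : w t = v t := by simp only [hw, Function.comp, hπe t ht]
    linarith
  · have huniv : ∀ (g : StieltjesFunction ℝ) (c : NNReal),
        (g.measure.restrict (Ioc 0 T) + c • Measure.dirac (0:ℝ)).real univ = g T - g 0 + c := by
      intro g c
      rw [← val g c T ⟨hT.le, le_rfl⟩]
      refine measureReal_congr ?_
      filter_upwards [ae_mem_Icc (supp g c)] with t ht
      simp only [eq_iff_iff]
      exact ⟨fun _ => ht.2, fun _ => trivial⟩
    rw [huniv, huniv, hpa, hqa, hpa, hqa]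
    have h1 : V T ≤ (eVariationOn v (Icc 0 T)).toReal :=
      (le_abs_self _).trans ((variationOnFromTo.abs_le_eVariationOn hwb).trans
        (ENNReal.toReal_mono hv hwle))
    linarith

lemma MemV.exists_isDecomp {T : ℝ} (hT : 0 < T) {v : ℝ → ℝ} (hv : MemV T v) :
    ∃ P N, IsDecomp T v P N :=
  let ⟨P, N, h, _⟩ := _root_.exists_isDecomp hT hv.1.1 hv.2
  ⟨P, N, h⟩

lemma MemA.exists_isDecomp {T : ℝ} (hT : 0 < T) {A : ℝ → ℝ} (hA : MemA T A) :
    ∃ P N, IsDecomp T A P N ∧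
      P.real univ + N.real univ ≤ (eVariationOn A (Icc 0 T)).toReal := by
  obtain ⟨P, N, h, hle⟩ := _root_.exists_isDecomp hT (v := A) (fun t ht => by
    refine ((hA.1 t ⟨ht.1, ht.2.le⟩).mono_of_mem_nhdsWithin ?_)
    refine mem_of_superset (Ioo_mem_nhdsGT ht.2) fun s hs => ⟨ht.1.trans hs.1.le, hs.2.le⟩) hA.2.1
  exact ⟨P, N, h, by simpa [hA.2.2] using hle⟩

lemma MemA.abs_intD_le {T : ℝ} (hT : 0 < T) {A f : ℝ → ℝ} (hA : MemA T A) (hf : BddMeas T f)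
    {C M : ℝ} (hC : ∀ t ∈ Icc (0:ℝ) T, |f t| ≤ C) (hM : 0 ≤ M)
    (hAM : eVariationOn A (Icc 0 T) ≤ ENNReal.ofReal M) : |intD T f A| ≤ C * M := by
  obtain ⟨P, N, h, hle⟩ := hA.exists_isDecomp hT
  have hC0 : 0 ≤ C := (abs_nonneg _).trans (hC 0 ⟨le_rfl, hT.le⟩)
  refine (h.abs_intD_le hT hf hC).trans (mul_le_mul_of_nonneg_left (hle.trans ?_) hC0)
  exact ENNReal.toReal_le_of_le_ofReal hM hAM

lemma integral_measureReal_Iic_eq {μ ν : Measure ℝ} [IsFiniteMeasure μ] [IsFiniteMeasure ν] :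
    ∫ u, μ.real (Iic u) ∂ν = ∫ s, ν.real (Ici s) ∂μ := by
  have hm : MeasurableSet {z : ℝ × ℝ | z.1 ≤ z.2} := measurableSet_le measurable_fst measurable_snd
  have h1 := Measure.prod_apply (μ := μ) (ν := ν) hm
  have h2 := Measure.prod_apply_symm (μ := μ) (ν := ν) hm
  have e1 : ∀ s : ℝ, Prod.mk s ⁻¹' {z : ℝ × ℝ | z.1 ≤ z.2} = Ici s := fun s => rfl
  have e2 : ∀ u : ℝ, (fun s => (s, u)) ⁻¹' {z : ℝ × ℝ | z.1 ≤ z.2} = Iic u := fun s => rfl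
  simp only [e1, e2] at h1 h2
  simp only [measureReal_def]
  rw [integral_toReal, integral_toReal, ← h1, ← h2]
  · exact (Antitone.measurable fun a b hab =>
      measure_mono (Ici_subset_Ici.2 hab)).aemeasurable
  · exact Eventually.of_forall fun s => measure_lt_top _ _
  · exact (Monotone.measurable fun a b hab =>
      measure_mono (Iic_subset_Iic.2 hab)).aemeasurable
  · exact Eventually.of_forall fun s => measure_lt_top _ _

lemma IsDecomp.sub_univ {T : ℝ} (hT : 0 < T) {v : ℝ → ℝ} {P N : Measure ℝ}
    (h : IsDecomp T v P N) : P.real univ - N.real univ = v T := by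
  rw [← h.sub T ⟨hT.le, le_rfl⟩]
  have : ∀ {Q : Measure ℝ}, Q (Icc 0 T)ᶜ = 0 → Q.real univ = Q.real (Iic T) := fun hQ => by
    refine measureReal_congr ?_
    filter_upwards [ae_mem_Icc hQ] with t ht
    simp only [eq_iff_iff]
    exact ⟨fun _ => ht.2, fun _ => trivial⟩
  rw [this h.suppP, this h.suppN]

/-- Continuity of the distribution function passes to open left half-lines. -/
lemma IsDecomp.sub_Iio {T : ℝ} {A : ℝ → ℝ} {P N : Measure ℝ}
    (h : IsDecomp T A P N) (hA : MemA T A) {s : ℝ} (hs : s ∈ Icc (0:ℝ) T) :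
    P.real (Iio s) - N.real (Iio s) = A s := by
  have := h.finP
  have := h.finN
  rcases hs.1.eq_or_lt with rfl | h0
  · have : ∀ {Q : Measure ℝ}, Q (Icc 0 T)ᶜ = 0 → Q.real (Iio 0) = 0 := fun hQ => by
      rw [measureReal_def, measure_mono_null _ hQ, ENNReal.toReal_zero]
      intro t ht ht'
      exact not_le.2 ht ht'.1
    rw [this h.suppP, this h.suppN, hA.2.2, sub_zero]
  · obtain ⟨u, hu, hus, hut⟩ := exists_seq_strictMono_tendsto' h0
    have hlim : ∀ {Q : Measure ℝ}, IsFiniteMeasure Q →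
        Tendsto (fun n => Q.real (Iic (u n))) atTop (𝓝 (Q.real (Iio s))) := by
      intro Q hQ
      rw [← iUnion_Iic_eq_Iio_of_lt_of_tendsto (fun n => (hus n).2) hut]
      exact (ENNReal.tendsto_toReal (measure_ne_top _ _)).comp
        (tendsto_measure_iUnion_atTop fun a b hab => Iic_subset_Iic.2 (hu.monotone hab))
    have huI : ∀ n, u n ∈ Icc (0:ℝ) T := fun n => ⟨(hus n).1.le, (hus n).2.le.trans hs.2⟩
    refine tendsto_nhds_unique ((hlim h.finP).sub (hlim h.finN)) ?_
    refine Tendsto.congr (fun n => (h.sub _ (huI n)).symm) ?_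
    exact (hA.1 s hs).tendsto.comp
      (tendsto_nhdsWithin_iff.2 ⟨hut, Eventually.of_forall huI⟩)

/-- Integration by parts. -/
lemma intD_eq_mul_sub_intD {T : ℝ} (hT : 0 < T) {v A : ℝ → ℝ} {P N : Measure ℝ}
    (hv : IsDecomp T v P N) (hvm : BddMeas T v) (hA : MemA T A) :
    intD T v A = v T * A T - intD T A v := by
  obtain ⟨P', N', h', -⟩ := hA.exists_isDecomp hT
  have := hv.finP
  have := hv.finN
  have := h'.finP
  have := h'.finN
  have hAm : BddMeas T A := hA.1.bddMeas
  rw [h'.intD_eq hT hvm, hv.intD_eq hT hAm]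
  have bm : ∀ {f : ℝ → ℝ} {ν : Measure ℝ}, IsFiniteMeasure ν → Measurable f →
      (∃ C, ∀ t, |f t| ≤ C) → Integrable f ν := by
    intro f ν _ hf ⟨C, hC⟩
    exact Integrable.of_bound hf.aestronglyMeasurable C (Eventually.of_forall hC)
  have iI : ∀ {μ ν : Measure ℝ}, IsFiniteMeasure μ → IsFiniteMeasure ν →
      Integrable (fun u => μ.real (Iic u)) ν := fun {μ ν} hμ hν =>
    bm hν (Monotone.measurable fun a b hab => measureReal_mono (Iic_subset_Iic.2 hab))
      ⟨μ.real univ, fun t => by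
        rw [abs_of_nonneg measureReal_nonneg]; exact measureReal_mono (subset_univ _)⟩
  have iJ : ∀ {μ ν : Measure ℝ}, IsFiniteMeasure μ → IsFiniteMeasure ν →
      Integrable (fun u => μ.real (Ici u)) ν := fun {μ ν} hμ hν =>
    bm hν (Antitone.measurable fun a b hab => measureReal_mono (Ici_subset_Ici.2 hab))
      ⟨μ.real univ, fun t => by
        rw [abs_of_nonneg measureReal_nonneg]; exact measureReal_mono (subset_univ _)⟩
  have e1 : ∀ {ν : Measure ℝ}, IsFiniteMeasure ν → ν (Icc 0 T)ᶜ = 0 →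
      ∫ u, v u ∂ν = ∫ s, ν.real (Ici s) ∂P - ∫ s, ν.real (Ici s) ∂N := by
    intro ν hν hs
    rw [← integral_measureReal_Iic_eq, ← integral_measureReal_Iic_eq,
      ← integral_sub (iI inferInstance inferInstance) (iI inferInstance inferInstance)]
    refine integral_congr_ae ?_
    filter_upwards [ae_mem_Icc hs] with t ht using (hv.sub t ht).symm
  have e2 : ∀ {μ : Measure ℝ}, IsFiniteMeasure μ → μ (Icc 0 T)ᶜ = 0 →
      ∫ s, P'.real (Ici s) ∂μ - ∫ s, N'.real (Ici s) ∂μ = A T * μ.real univ - ∫ s, A s ∂μ := by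
    intro μ hμ hs
    rw [← integral_sub (iJ inferInstance inferInstance) (iJ inferInstance inferInstance)]
    have : A T * μ.real univ = ∫ _, A T ∂μ := by simp [mul_comm]
    rw [this, ← integral_sub (integrable_const _) (hAm.integrable hs)]
    refine integral_congr_ae ?_
    filter_upwards [ae_mem_Icc hs] with t ht
    have h1 : ∀ {Q : Measure ℝ}, IsFiniteMeasure Q → Q.real (Ici t) = Q.real univ - Q.real (Iio t) :=
      fun {Q} hQ => by rw [← compl_Iio, measureReal_compl measurableSet_Iio]
    rw [h1 inferInstance, h1 inferInstance, ← h'.sub_Iio hA ht, ← h'.sub_univ hT]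
    ring
  rw [e1 inferInstance h'.suppP, e1 inferInstance h'.suppN]
  have h1 := e2 inferInstance hv.suppP
  have h2 := e2 inferInstance hv.suppN
  rw [← hv.sub_univ hT]
  linarith

lemma intD_one {T : ℝ} (hT : 0 < T) {v : ℝ → ℝ} {P N : Measure ℝ} (hv : IsDecomp T v P N) :
    intD T (fun _ => 1) v = v T := by
  rw [hv.intD_eq hT continuousOn_const.bddMeas, ← hv.sub_univ hT]
  simp

lemma eVariationOn_add_le (f g : ℝ → ℝ) (s : Set ℝ) :
    eVariationOn (fun t => f t + g t) s ≤ eVariationOn f s + eVariationOn g s := by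
  refine iSup_le fun p => ?_
  calc ∑ i ∈ Finset.range p.1, edist (f (p.2.1 (i + 1)) + g (p.2.1 (i + 1)))
          (f (p.2.1 i) + g (p.2.1 i))
      ≤ ∑ i ∈ Finset.range p.1, (edist (f (p.2.1 (i + 1))) (f (p.2.1 i)) +
          edist (g (p.2.1 (i + 1))) (g (p.2.1 i))) :=
        Finset.sum_le_sum fun i _ => edist_add_add_le _ _ _ _
    _ ≤ _ := by
        rw [Finset.sum_add_distrib]
        exact add_le_add (eVariationOn.sum_le p.2.2.1 p.2.2.2)
          (eVariationOn.sum_le p.2.2.1 p.2.2.2)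

lemma eVariationOn_const_mul_le (c : ℝ) (f : ℝ → ℝ) (s : Set ℝ) :
    eVariationOn (fun t => c * f t) s ≤ ENNReal.ofReal |c| * eVariationOn f s := by
  refine iSup_le fun p => ?_
  calc ∑ i ∈ Finset.range p.1, edist (c * f (p.2.1 (i + 1))) (c * f (p.2.1 i))
      = ∑ i ∈ Finset.range p.1, ENNReal.ofReal |c| * edist (f (p.2.1 (i + 1))) (f (p.2.1 i)) := by
        refine Finset.sum_congr rfl fun i _ => ?_
        rw [edist_dist, edist_dist, Real.dist_eq, Real.dist_eq, ← mul_sub, abs_mul,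
          ENNReal.ofReal_mul (abs_nonneg c)]
    _ ≤ _ := by
        rw [← Finset.mul_sum]
        gcongr
        exact eVariationOn.sum_le p.2.2.1 p.2.2.2

lemma Cadlag.add {T : ℝ} {x y : ℝ → ℝ} (hx : Cadlag T x) (hy : Cadlag T y) :
    Cadlag T (fun t => x t + y t) := by
  refine ⟨fun t ht => (hx.1 t ht).add (hy.1 t ht), fun t ht => ?_⟩
  obtain ⟨L, hL⟩ := hx.2 t ht
  obtain ⟨L', hL'⟩ := hy.2 t ht
  exact ⟨_, hL.add hL'⟩

lemma Cadlag.const_mul {T : ℝ} {x : ℝ → ℝ} (hx : Cadlag T x) (c : ℝ) :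
    Cadlag T (fun t => c * x t) := by
  refine ⟨fun t ht => (hx.1 t ht).const_mul c, fun t ht => ?_⟩
  obtain ⟨L, hL⟩ := hx.2 t ht
  exact ⟨_, hL.const_mul c⟩

lemma MemV.add {T : ℝ} {x y : ℝ → ℝ} (hx : MemV T x) (hy : MemV T y) :
    MemV T (fun t => x t + y t) :=
  ⟨hx.1.add hy.1, ne_top_of_le_ne_top (ENNReal.add_ne_top.2 ⟨hx.2, hy.2⟩)
    (eVariationOn_add_le _ _ _)⟩

lemma MemV.const_mul {T : ℝ} {x : ℝ → ℝ} (hx : MemV T x) (c : ℝ) :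
    MemV T (fun t => c * x t) :=
  ⟨hx.1.const_mul c, ne_top_of_le_ne_top (ENNReal.mul_ne_top ENNReal.ofReal_ne_top hx.2)
    (eVariationOn_const_mul_le _ _ _)⟩

/-- The unit jump at `s`. -/
def unitJump (s t : ℝ) : ℝ := if s ≤ t then 1 else 0

lemma memV_unitJump {T : ℝ} (s : ℝ) : MemV T (unitJump s) := by
  refine ⟨⟨fun t _ => ?_, fun t _ => ?_⟩, ?_⟩
  · rcases le_or_gt s t with h | h
    · refine (tendsto_congr' ?_).2 tendsto_const_nhds
      filter_upwards [self_mem_nhdsWithin] with u (hu : t < u)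
      simp [unitJump, h, h.trans hu.le]
    · refine (tendsto_congr' ?_).2 tendsto_const_nhds
      filter_upwards [Ioo_mem_nhdsGT h] with u hu
      simp only [unitJump, if_neg (not_le.2 hu.2), if_neg (not_le.2 h)]
  · rcases lt_or_ge s t with h | h
    · refine ⟨1, (tendsto_congr' ?_).2 tendsto_const_nhds⟩
      filter_upwards [Ioo_mem_nhdsLT h] with u hu
      simp [unitJump, hu.1.le]
    · refine ⟨0, (tendsto_congr' ?_).2 tendsto_const_nhds⟩
      filter_upwards [self_mem_nhdsWithin] with u (hu : u < t)
      simp [unitJump, hu.trans_le h]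
  · have hm : Monotone (unitJump s) := by
      intro a b hab
      unfold unitJump
      split_ifs <;> linarith
    by_cases hT : 0 ≤ T
    · have := (hm.monotoneOn (Icc 0 T)).eVariationOn_eq (left_mem_Icc.2 hT) (right_mem_Icc.2 hT)
      rw [inter_self] at this
      exact ne_top_of_le_ne_top ENNReal.ofReal_ne_top this.le
    · rw [Icc_eq_empty hT]
      simp [BoundedVariationOn, eVariationOn.subsingleton]

lemma isDecomp_unitJump {T s : ℝ} (hs : s ∈ Icc 0 T) :
    IsDecomp T (unitJump s) (Measure.dirac s) 0 where
  finP := inferInstance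
  finN := inferInstance
  suppP := by simp [measurableSet_Icc.compl, hs.1, hs.2]
  suppN := by simp
  sub t _ := by
    simp only [measureReal_def, Measure.dirac_apply' _ measurableSet_Iic, unitJump, indicator,
      mem_Iic]
    split_ifs <;> simp

lemma intD_unitJump {T s : ℝ} (hT : 0 < T) (hs : s ∈ Icc 0 T) {f : ℝ → ℝ} (hf : BddMeas T f) :
    intD T f (unitJump s) = f s := by
  rw [(isDecomp_unitJump hs).intD_eq hT hf]
  simp

/-- The step function with jumps of size `(p i).1` at the points `(p i).2`. -/
def stepFun {d : ℕ} (p : Fin d → ℝ × ℝ) (t : ℝ) : ℝ := ∑ i, (p i).1 * unitJump (p i).2 t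

lemma memV_stepFun {T : ℝ} {d : ℕ} (p : Fin d → ℝ × ℝ) : MemV T (stepFun p) := by
  have h : ∀ s : Finset (Fin d), MemV T (fun t => ∑ i ∈ s, (p i).1 * unitJump (p i).2 t) := by
    intro s
    induction s using Finset.cons_induction with
    | empty =>
      simpa using (memV_unitJump (T := T) 0).const_mul 0
    | cons a s ha ih =>
      simp only [Finset.sum_cons]
      exact ((memV_unitJump _).const_mul _).add ih
  exact h Finset.univ

lemma intD_stepFun {T : ℝ} (hT : 0 < T) {d : ℕ} {p : Fin d → ℝ × ℝ}
    (hp : ∀ i, (p i).2 ∈ Icc 0 T) {f : ℝ → ℝ} (hf : BddMeas T f) :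
    intD T f (stepFun p) = ∑ i, (p i).1 * f (p i).2 := by
  have h := (IsDecomp.sum hT Finset.univ (v := fun i t => (p i).1 * unitJump (p i).2 t)
    (fun i _ => ⟨_, _, (isDecomp_unitJump (hp i)).const_mul (p i).1⟩)).2 f hf
  refine h.trans (Finset.sum_congr rfl fun i _ => ?_)
  rw [(isDecomp_unitJump (hp i)).intD_const_mul hT hf, intD_unitJump hT (hp i) hf]

lemma measurable_stepFun {d : ℕ} (p : Fin d → ℝ × ℝ) : Measurable (stepFun p) := by
  refine Finset.measurable_sum _ fun i _ => Measurable.const_mul ?_ _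
  exact Measurable.ite measurableSet_Ici measurable_const measurable_const

lemma abs_stepFun_le {d : ℕ} (p : Fin d → ℝ × ℝ) (t : ℝ) : |stepFun p t| ≤ ∑ i, |(p i).1| := by
  refine (Finset.abs_sum_le_sum_abs _ _).trans (Finset.sum_le_sum fun i _ => ?_)
  rw [abs_mul]
  refine mul_le_of_le_one_right (abs_nonneg _) ?_
  unfold unitJump
  split_ifs <;> simp

lemma stepFun_cons {d : ℕ} (p : Fin d → ℝ × ℝ) (q : ℝ × ℝ) (t : ℝ) :
    stepFun (Fin.cons q p : Fin (d + 1) → ℝ × ℝ) t = q.1 * unitJump q.2 t + stepFun p t := by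
  simp [stepFun, Fin.sum_univ_succ]

/-- `x` is approximated within `ε` on `[s,T]` by a step function with `d` jumps of size at most
`B` located in `[s,T]`. -/
def StepApprox (T : ℝ) (x : ℝ → ℝ) (ε B : ℝ) (d : ℕ) (s : ℝ) : Prop :=
  ∃ p : Fin d → ℝ × ℝ, (∀ i, |(p i).1| ≤ B ∧ (p i).2 ∈ Icc s T) ∧
    ∀ t ∈ Icc s T, |x t - stepFun p t| ≤ ε

lemma stepApprox_one {T : ℝ} {x : ℝ → ℝ} {ε B s c : ℝ} (hs : s ≤ T) (hc : |c| ≤ B)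
    (h : ∀ t ∈ Icc s T, |x t - c| ≤ ε) : StepApprox T x ε B 1 s := by
  refine ⟨fun _ => (c, s), fun _ => ⟨hc, le_rfl, hs⟩, fun t ht => ?_⟩
  simpa [stepFun, unitJump, ht.1] using h t ht

lemma StepApprox.mono_dim {T : ℝ} {x : ℝ → ℝ} {ε B s : ℝ} {d d' : ℕ}
    (h : StepApprox T x ε B d s) (hB : 0 ≤ B) (hs : s ≤ T) (hd : d ≤ d') :
    StepApprox T x ε B d' s := by
  induction hd with
  | refl => exact h
  | step _ ih =>
    obtain ⟨p, hp, hp'⟩ := ih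
    refine ⟨Fin.cons (0, s) p, ?_, fun t ht => ?_⟩
    · rw [Fin.forall_fin_succ]
      exact ⟨by simpa using ⟨hB, hs⟩, by simpa using hp⟩
    · rw [stepFun_cons]
      simpa using hp' t ht

lemma StepApprox.mono_bound {T : ℝ} {x : ℝ → ℝ} {ε B B' s : ℝ} {d : ℕ}
    (h : StepApprox T x ε B d s) (hB : B ≤ B') : StepApprox T x ε B' d s :=
  let ⟨p, hp, hp'⟩ := h
  ⟨p, fun i => ⟨(hp i).1.trans hB, (hp i).2⟩, hp'⟩

lemma StepApprox.extend {T : ℝ} {x : ℝ → ℝ} {ε B s s' c : ℝ} {d : ℕ}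
    (h : StepApprox T x ε B d s) (hs : s' ≤ s) (hsT : s ≤ T) (hc : |c| ≤ B)
    (hx : ∀ t ∈ Ico s' s, |x t - c| ≤ ε) : StepApprox T x ε B (d + 2) s' := by
  obtain ⟨p, hp, hp'⟩ := h
  refine ⟨Fin.cons (c, s') (Fin.cons (-c, s) p), ?_, fun t ht => ?_⟩
  · rw [Fin.forall_fin_succ, Fin.forall_fin_succ]
    refine ⟨by simpa using ⟨hc, hs.trans hsT⟩, by simpa using ⟨hc, hs, hsT⟩, fun i => ?_⟩
    simpa using ⟨(hp i).1, hs.trans (hp i).2.1, (hp i).2.2⟩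
  · rw [stepFun_cons, stepFun_cons]
    rcases lt_or_ge t s with hts | hts
    · have h0 : stepFun p t = 0 := by
        refine Finset.sum_eq_zero fun i _ => ?_
        simp [unitJump, hts.trans_le (hp i).2.1]
      simpa [h0, unitJump, ht.1, not_le.2 hts] using hx t ⟨ht.1, hts⟩
    · simpa [unitJump, ht.1, hts] using hp' t ⟨hts, ht.2⟩

lemma Cadlag.exists_stepApprox {T : ℝ} (hT : 0 < T) {x : ℝ → ℝ} (hx : Cadlag T x) {ε : ℝ}
    (hε : 0 < ε) : ∃ B d, StepApprox T x ε B d 0 := by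
  set S : Set ℝ := {s | s ∈ Icc 0 T ∧ ∃ B d, StepApprox T x ε B d s} with hS
  have hTS : T ∈ S := by
    refine ⟨⟨hT.le, le_rfl⟩, |x T|, 1, stepApprox_one le_rfl le_rfl fun t ht => ?_⟩
    rw [Icc_self, mem_singleton_iff] at ht
    simp [ht, hε.le]
  have hbd : BddBelow S := ⟨0, fun s hs => hs.1.1⟩
  have hext : ∀ s ∈ S, ∀ s' c, 0 ≤ s' → s' ≤ s → (∀ t ∈ Ico s' s, |x t - c| ≤ ε) → s' ∈ S := by
    rintro s ⟨hs, B, d, h⟩ s' c h0 hss hc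
    exact ⟨⟨h0, hss.trans hs.2⟩, max B |c|, d + 2,
      (h.mono_bound (le_max_left _ _)).extend hss hs.2 (le_max_right _ _) hc⟩
  set σ := sInf S with hσ
  have hσ0 : 0 ≤ σ := le_csInf ⟨T, hTS⟩ fun s hs => hs.1.1
  have hσT : σ ≤ T := csInf_le hbd hTS
  have hσS : σ ∈ S := by
    rcases hσT.eq_or_lt with h | h
    · rw [h]
      exact hTS
    · have h1 := (hx.1 σ ⟨hσ0, h⟩).eventually (Metric.closedBall_mem_nhds _ hε)
      obtain ⟨u, hu, hu'⟩ := (mem_nhdsGT_iff_exists_Ioo_subset).1 h1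
      obtain ⟨s, hs, hsu⟩ := exists_lt_of_csInf_lt ⟨T, hTS⟩ (show sInf S < u from hu)
      refine hext s hs σ (x σ) hσ0 (csInf_le hbd hs) fun t ht => ?_
      rcases ht.1.eq_or_lt with h2 | h2
      · simp [← h2, hε.le]
      · exact hu' ⟨h2, ht.2.trans hsu⟩
  rcases hσ0.eq_or_lt with h | h
  · rw [← h] at hσS
    exact hσS.2
  · obtain ⟨L, hL⟩ := hx.2 σ ⟨h, hσT⟩
    have h1 := hL.eventually (Metric.closedBall_mem_nhds _ hε)
    obtain ⟨u, hu, hu'⟩ := (mem_nhdsLT_iff_exists_Ioo_subset).1 h1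
    have hu : u < σ := hu
    obtain ⟨w, hw, hw'⟩ := exists_between (max_lt hu h)
    have := hext σ hσS w L ((le_max_right _ _).trans hw.le) hw'.le fun t ht =>
      hu' ⟨((le_max_left _ _).trans_lt hw).trans_le ht.1, ht.2⟩
    exact absurd (csInf_le hbd this) (not_le.2 hw')

lemma Cadlag.bddMeas {T : ℝ} (hT : 0 < T) {x : ℝ → ℝ} (hx : Cadlag T x) : BddMeas T x := by
  constructor
  · have h : ∀ n : ℕ, ∃ g : ℝ → ℝ, Measurable g ∧ ∀ t ∈ Icc 0 T, |x t - g t| ≤ 1 / ((n:ℝ) + 1) := by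
      intro n
      obtain ⟨B, d, p, -, hp⟩ := hx.exists_stepApprox hT (Nat.one_div_pos_of_nat (n := n) (α := ℝ))
      exact ⟨_, measurable_stepFun p, hp⟩
    choose g hg hg' using h
    refine measurable_of_tendsto_metrizable (f := fun n => (Icc 0 T).indicator (g n))
      (fun n => (hg n).indicator measurableSet_Icc) ?_
    rw [tendsto_pi_nhds]
    intro t
    by_cases ht : t ∈ Icc 0 T
    · simp only [indicator_of_mem ht]
      rw [tendsto_iff_dist_tendsto_zero]
      refine squeeze_zero (fun _ => dist_nonneg) (fun n => ?_)
        (tendsto_one_div_add_atTop_nhds_zero_nat (𝕜 := ℝ))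
      rw [dist_comm]
      exact hg' n t ht
    · simp [indicator_of_notMem ht]
  · obtain ⟨B, d, p, -, hp⟩ := hx.exists_stepApprox hT one_pos
    refine ⟨1 + ∑ i, |(p i).1|, fun t ht => ?_⟩
    have h1 := abs_sub_abs_le_abs_sub (x t) (stepFun p t)
    linarith [hp t ht, abs_stepFun_le p t]

/-- `x` has `k` consecutive increments larger than `η` in absolute value along points of `[s,T]`
starting at `s`. -/
def IncrChain (T : ℝ) (x : ℝ → ℝ) (η : ℝ) (k : ℕ) (s : ℝ) : Prop :=
  ∃ u : ℕ → ℝ, u 0 = s ∧ (∀ i ≤ k, u i ∈ Icc s T) ∧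
    ∀ i < k, u i < u (i + 1) ∧ η < |x (u (i + 1)) - x (u i)|

lemma IncrChain.cons {T : ℝ} {x : ℝ → ℝ} {η : ℝ} {k : ℕ} {s s' : ℝ} (h : IncrChain T x η k s)
    (hs : s' < s) (hx : η < |x s - x s'|) (hT : s' ≤ T) : IncrChain T x η (k + 1) s' := by
  obtain ⟨u, h0, hu, hu'⟩ := h
  refine ⟨fun i => Nat.casesOn i s' u, rfl, ?_, ?_⟩
  · rintro (_ | i) hi
    · exact ⟨le_rfl, hT⟩
    · have := hu i (by omega)
      exact ⟨hs.le.trans this.1, this.2⟩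
  · rintro (_ | i) hi
    · simpa [h0] using ⟨hs, hx⟩
    · exact hu' i (by omega)

lemma stepApprox_of_not_incrChain {T : ℝ} {x : ℝ → ℝ} {η ε B : ℝ}
    (hr : ∀ t ∈ Ico (0:ℝ) T, Tendsto x (𝓝[>] t) (𝓝 (x t)))
    (hB : ∀ t ∈ Icc (0:ℝ) T, |x t| ≤ B) (hη : 0 < η) (hηε : η < ε) (K : ℕ) :
    ∀ s ∈ Icc (0:ℝ) T, ¬ IncrChain T x η K s → StepApprox T x ε B (2 * K + 1) s := by
  induction K with
  | zero =>
    intro s hs h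
    refine absurd ⟨fun _ => s, rfl, fun _ _ => ⟨le_rfl, hs.2⟩, fun i hi => ?_⟩ h
    omega
  | succ K ih =>
    intro s hs h
    have hB0 : 0 ≤ B := (abs_nonneg _).trans (hB s hs)
    set E : Set ℝ := {t | t ∈ Icc s T ∧ ε < |x t - x s|} with hE
    rcases E.eq_empty_or_nonempty with hE0 | hne
    · refine (stepApprox_one hs.2 (hB s hs) fun t ht => ?_).mono_dim hB0 hs.2 (by omega)
      by_contra hc
      exact eq_empty_iff_forall_notMem.1 hE0 t ⟨ht, not_le.1 hc⟩
    · have hbd : BddBelow E := ⟨s, fun t ht => ht.1.1⟩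
      set τ := sInf E with hτ
      have hsτ : s ≤ τ := le_csInf hne fun t ht => ht.1.1
      obtain ⟨t₀, ht₀⟩ := hne
      have hτT : τ ≤ T := (csInf_le hbd ht₀).trans ht₀.1.2
      have hjump : ε ≤ |x τ - x s| := by
        by_contra! hlt
        have hτE : τ ∉ E := fun h => (h.2.trans hlt).false
        have hτT' : τ < T := by
          refine lt_of_le_of_ne hτT fun h => hτE ?_
          have : t₀ = τ := le_antisymm (ht₀.1.2.trans h.ge) (csInf_le hbd ht₀)
          exact this ▸ ht₀
        have h1 := (((hr τ ⟨hs.1.trans hsτ, hτT'⟩).sub_const (x s)).abs).eventually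
          (Iio_mem_nhds hlt)
        obtain ⟨u, hu, hu'⟩ := (mem_nhdsGT_iff_exists_Ioo_subset).1 h1
        obtain ⟨t, ht, htu⟩ := exists_lt_of_csInf_lt ⟨t₀, ht₀⟩ (show sInf E < u from hu)
        have htτ : τ < t := lt_of_le_of_ne (csInf_le hbd ht) fun h => hτE (h ▸ ht)
        exact (ht.2.trans (hu' ⟨htτ, htu⟩)).false
      have hlt : s < τ := by
        refine lt_of_le_of_ne hsτ fun h => ?_
        rw [← h, sub_self, abs_zero] at hjump
        linarith
      have hτI : τ ∈ Icc 0 T := ⟨hs.1.trans hsτ, hτT⟩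
      have hnc : ¬ IncrChain T x η K τ := fun hc =>
        h (hc.cons hlt (hηε.trans_le hjump) hs.2)
      refine (ih τ hτI hnc).extend hsτ hτT (hB s hs) fun t ht => ?_
      by_contra! hc
      exact (notMem_of_lt_csInf ht.2 hbd) ⟨⟨ht.1, ht.2.le.trans hτT⟩, hc⟩

/-- A function continuous on `[0,T]` is the restriction of a globally continuous one. -/
lemma exists_continuous_eqOn_Icc {T : ℝ} (hT : 0 < T) {f : ℝ → ℝ}
    (hf : ContinuousOn f (Icc 0 T)) {b : ℝ} (hb : ∀ t ∈ Icc (0:ℝ) T, |f t| ≤ b) :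
    ∃ g : ℝ → ℝ, Continuous g ∧ EqOn f g (Icc 0 T) ∧ ∀ t, |g t| ≤ b :=
  ⟨IccExtend hT.le ((Icc 0 T).domRestrict f), hf.domRestrict.Icc_extend', fun t ht => by
    rw [IccExtend_of_mem _ _ ht, domRestrict_apply], fun t => hb _ (projIcc 0 T hT.le t).2⟩

/-- A weakly convergent sequence of signed measures is norm bounded. -/
lemma exists_bound_of_weak_tendsto {T : ℝ} (hT : 0 < T) {v : ℕ → ℝ → ℝ} (hv : ∀ k, MemV T (v k))
    (hw : ∀ f, Continuous f → ∃ l, Tendsto (fun k => intD T f (v k)) atTop (𝓝 l)) :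
    ∃ C, ∀ k f b, ContinuousOn f (Icc 0 T) → (∀ t ∈ Icc (0:ℝ) T, |f t| ≤ b) →
      |intD T f (v k)| ≤ C * b := by
  choose P N h using fun k => (hv k).exists_isDecomp hT
  have hbm : ∀ f : BoundedContinuousFunction ℝ ℝ, BddMeas T f := fun f =>
    f.continuous.continuousOn.bddMeas
  let g : ℕ → BoundedContinuousFunction ℝ ℝ →L[ℝ] ℝ := fun k =>
    LinearMap.mkContinuous
      { toFun := fun f => intD T f (v k)
        map_add' := fun f f' => by
          have := (h k).finP
          have := (h k).finN
          rw [(h k).intD_eq hT (hbm _), (h k).intD_eq hT (hbm _), (h k).intD_eq hT (hbm _)]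
          simp only [BoundedContinuousFunction.coe_add, Pi.add_apply]
          rw [integral_add ((hbm f).integrable (h k).suppP) ((hbm f').integrable (h k).suppP),
            integral_add ((hbm f).integrable (h k).suppN) ((hbm f').integrable (h k).suppN)]
          ring
        map_smul' := fun c f => by
          rw [(h k).intD_eq hT (hbm _), (h k).intD_eq hT (hbm _)]
          simp only [BoundedContinuousFunction.coe_smul, smul_eq_mul, integral_const_mul,
            RingHom.id_apply]
          ring }
      ((P k).real univ + (N k).real univ)
      (fun f => ((h k).abs_intD_le hT (hbm f) fun t _ => f.norm_coe_le_norm t).trans_eq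
        (mul_comm _ _))
  obtain ⟨C, hC⟩ := banach_steinhaus (g := g) fun f => by
    obtain ⟨l, hl⟩ := hw f f.continuous
    obtain ⟨C, hC⟩ := (Metric.isBounded_range_of_tendsto _ hl).exists_norm_le
    exact ⟨C, fun k => hC _ ⟨k, rfl⟩⟩
  refine ⟨C, fun k f b hf hb => ?_⟩
  obtain ⟨f', hf', heq, hb'⟩ := exists_continuous_eqOn_Icc hT hf hb
  have hb0 : 0 ≤ b := (abs_nonneg _).trans (hb' 0)
  let F := BoundedContinuousFunction.ofNormedAddCommGroup f' hf' b hb'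
  rw [intD_congr hT (h k) hf.bddMeas hf'.continuousOn.bddMeas heq]
  calc |intD T f' (v k)| = ‖g k F‖ := rfl
    _ ≤ ‖g k‖ * ‖F‖ := (g k).le_opNorm F
    _ ≤ C * b := by
        have hF : ‖F‖ ≤ b := BoundedContinuousFunction.norm_ofNormedAddCommGroup_le _ hb0 hb'
        have : 0 ≤ C := (norm_nonneg _).trans (hC k)
        gcongr
        exact hC k

lemma tendsto_apply_of_weak_tendsto {T : ℝ} (hT : 0 < T) {v : ℕ → ℝ → ℝ} {v₀ : ℝ → ℝ}
    (hv : ∀ k, MemV T (v k)) (hv₀ : MemV T v₀)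
    (hw : ∀ f, Continuous f → Tendsto (fun k => intD T f (v k)) atTop (𝓝 (intD T f v₀))) :
    Tendsto (fun k => v k T) atTop (𝓝 (v₀ T)) := by
  obtain ⟨P, N, h⟩ := hv₀.exists_isDecomp hT
  have h1 := hw (fun _ => 1) continuous_const
  rw [intD_one hT h] at h1
  refine h1.congr fun k => ?_
  obtain ⟨P, N, h⟩ := (hv k).exists_isDecomp hT
  exact intD_one hT h

lemma tendsto_intD_of_weak_tendsto {T : ℝ} (hT : 0 < T) {v A : ℕ → ℝ → ℝ} {v₀ A₀ : ℝ → ℝ}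
    (hv : ∀ k, MemV T (v k)) (hv₀ : MemV T v₀)
    (hw : ∀ f, Continuous f → Tendsto (fun k => intD T f (v k)) atTop (𝓝 (intD T f v₀)))
    (hA : ∀ k, MemA T (A k)) (hA₀ : MemA T A₀)
    (hAA : TendstoUniformlyOn (fun n => A n) A₀ atTop (Icc 0 T)) :
    Tendsto (fun k => intD T (v k) (A k)) atTop (𝓝 (intD T v₀ A₀)) := by
  have hTT : T ∈ Icc 0 T := ⟨hT.le, le_rfl⟩
  choose P N h using fun k => (hv k).exists_isDecomp hT
  obtain ⟨P₀, N₀, h₀⟩ := hv₀.exists_isDecomp hT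
  obtain ⟨C, hC⟩ := exists_bound_of_weak_tendsto hT hv fun f hf => ⟨_, hw f hf⟩
  rw [intD_eq_mul_sub_intD hT h₀ (hv₀.1.bddMeas hT) hA₀]
  simp_rw [fun k => intD_eq_mul_sub_intD hT (h k) ((hv k).1.bddMeas hT) (hA k)]
  refine ((tendsto_apply_of_weak_tendsto hT hv hv₀ hw).mul (hAA.tendsto_at hTT)).sub ?_
  have h1 : Tendsto (fun k => intD T A₀ (v k)) atTop (𝓝 (intD T A₀ v₀)) := by
    obtain ⟨b, hb⟩ := hA₀.1.bddMeas.2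
    obtain ⟨g, hg, heq, -⟩ := exists_continuous_eqOn_Icc hT hA₀.1 hb
    rw [intD_congr hT h₀ hA₀.1.bddMeas hg.continuousOn.bddMeas heq]
    exact (hw g hg).congr fun k =>
      (intD_congr hT (h k) hA₀.1.bddMeas hg.continuousOn.bddMeas heq).symm
  have h2 : Tendsto (fun k => intD T (fun t => A k t - A₀ t) (v k)) atTop (𝓝 0) := by
    rw [Metric.tendsto_atTop]
    intro ε hε
    obtain ⟨K, hK⟩ := eventually_atTop.1
      (Metric.tendstoUniformlyOn_iff.1 hAA (ε / (|C| + 1)) (by positivity))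
    refine ⟨K, fun k hk => ?_⟩
    rw [Real.dist_eq, sub_zero]
    calc _ ≤ C * (ε / (|C| + 1)) := hC k _ _ ((hA k).1.sub hA₀.1) fun t ht => by
          have := (hK k hk t ht).le
          rwa [dist_comm, Real.dist_eq] at this
      _ < (|C| + 1) * (ε / (|C| + 1)) := by
          gcongr
          linarith [le_abs_self C]
      _ = ε := by field_simp
  have h3 := h1.add h2
  rw [add_zero] at h3
  refine h3.congr fun k => ?_
  rw [intD_sub hT (h k) (hA k).1.bddMeas hA₀.1.bddMeas]
  ring

/-- Joint continuity of the integral along `→_S` and `→_τ`. -/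
lemma SConv.tendsto_intD {T : ℝ} (hT : 0 < T) {y A : ℕ → ℝ → ℝ} {x₀ A₀ : ℝ → ℝ}
    (hs : SConv T y x₀) (hy : ∀ k, Cadlag T (y k)) (hx₀ : Cadlag T x₀)
    (hA : ∀ k, MemA T (A k)) (hA₀ : MemA T A₀) (hτ : TauConv T A A₀) :
    Tendsto (fun k => intD T (y k) (A k)) atTop (𝓝 (intD T x₀ A₀)) := by
  obtain ⟨hAA, M', hM'⟩ := hτ
  set M := max M' (eVariationOn A₀ (Icc 0 T)).toReal with hMdef
  have hM0 : 0 ≤ M := ENNReal.toReal_nonneg.trans (le_max_right _ _)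
  have hM : ∀ n, eVariationOn (A n) (Icc 0 T) ≤ ENNReal.ofReal M := fun n =>
    (hM' n).trans (ENNReal.ofReal_le_ofReal (le_max_left _ _))
  have hM₀ : eVariationOn A₀ (Icc 0 T) ≤ ENNReal.ofReal M := by
    rw [← ENNReal.ofReal_toReal hA₀.2.1]
    exact ENNReal.ofReal_le_ofReal (le_max_right _ _)
  rw [Metric.tendsto_atTop]
  intro ε hε
  set δ := ε / (2 * (M + 1)) with hδ
  have hδ0 : 0 < δ := by positivity
  obtain ⟨v, v₀, hv, hv₀, hyv, hxv, hw⟩ := hs δ hδ0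
  obtain ⟨K, hK⟩ := Metric.tendsto_atTop.1
    (tendsto_intD_of_weak_tendsto hT hv hv₀ hw hA hA₀ hAA) δ hδ0
  have hdiff : ∀ {z w B : ℝ → ℝ}, Cadlag T z → MemV T w → MemA T B →
      eVariationOn B (Icc 0 T) ≤ ENNReal.ofReal M → (∀ t ∈ Icc (0:ℝ) T, |z t - w t| ≤ δ) →
      |intD T z B - intD T w B| ≤ δ * M := by
    intro z w B hz hw hB hBM hzw
    obtain ⟨P, N, h, -⟩ := hB.exists_isDecomp hT
    rw [← intD_sub hT h (hz.bddMeas hT) (hw.1.bddMeas hT)]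
    exact hB.abs_intD_le hT ((hz.bddMeas hT).sub (hw.1.bddMeas hT)) hzw hM0 hBM
  refine ⟨K, fun k hk => ?_⟩
  have h1 := hdiff (hy k) (hv k) (hA k) (hM k) (hyv k)
  have h2 := hdiff hx₀ hv₀ hA₀ hM₀ hxv
  have h3 := hK k hk
  rw [Real.dist_eq] at h3 ⊢
  have h4 : 2 * (M + 1) * δ = ε := by
    rw [hδ]
    field_simp
  rw [abs_lt] at h3 ⊢
  rw [abs_le] at h1 h2
  constructor <;> nlinarith [h1.1, h1.2, h2.1, h2.2, h3.1, h3.2]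

lemma sConv_const {T : ℝ} (hT : 0 < T) {x₀ : ℝ → ℝ} (hx₀ : Cadlag T x₀) :
    SConv T (fun _ => x₀) x₀ := by
  intro ε hε
  obtain ⟨B, d, p, -, hp⟩ := hx₀.exists_stepApprox hT hε
  exact ⟨fun _ => stepFun p, stepFun p, fun _ => memV_stepFun p, memV_stepFun p, fun _ => hp, hp,
    fun _ _ => tendsto_const_nhds⟩

lemma SConv.tendsto_apply {T : ℝ} (hT : 0 < T) {y : ℕ → ℝ → ℝ} {x₀ : ℝ → ℝ}
    (hs : SConv T y x₀) : Tendsto (fun k => y k T) atTop (𝓝 (x₀ T)) := by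
  have hTT : T ∈ Icc 0 T := ⟨hT.le, le_rfl⟩
  rw [Metric.tendsto_atTop]
  intro ε hε
  obtain ⟨v, v₀, hv, hv₀, hyv, hxv, hw⟩ := hs (ε / 3) (by positivity)
  obtain ⟨K, hK⟩ := Metric.tendsto_atTop.1 (tendsto_apply_of_weak_tendsto hT hv hv₀ hw) (ε / 3)
    (by positivity)
  refine ⟨K, fun k hk => ?_⟩
  have h1 := hyv k T hTT
  have h2 := hxv T hTT
  have h3 := hK k hk
  rw [Real.dist_eq] at h3 ⊢
  rw [abs_lt] at h3 ⊢
  rw [abs_le] at h1 h2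
  constructor <;> linarith [h1.1, h1.2, h2.1, h2.2, h3.1, h3.2]

lemma TauConv.comp {T : ℝ} {A : ℕ → ℝ → ℝ} {A₀ : ℝ → ℝ} (h : TauConv T A A₀) {φ : ℕ → ℕ}
    (hφ : StrictMono φ) : TauConv T (fun k => A (φ k)) A₀ :=
  ⟨fun u hu => hφ.tendsto_atTop.eventually (h.1 u hu), h.2.imp fun _ hM n => hM (φ n)⟩

lemma SStarConv.tendsto_apply {T : ℝ} (hT : 0 < T) {x : ℕ → ℝ → ℝ} {x₀ : ℝ → ℝ}
    (hs : SStarConv T x x₀) : Tendsto (fun n => x n T) atTop (𝓝 (x₀ T)) := by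
  refine tendsto_of_subseq_tendsto fun ns hns => ?_
  obtain ⟨φ, hφ, hφ'⟩ := strictMono_subseq_of_tendsto_atTop hns
  obtain ⟨ψ, hψ, h⟩ := hs _ hφ'
  exact ⟨φ ∘ ψ, h.tendsto_apply hT⟩

lemma SStarConv.uniform_intD {T : ℝ} (hT : 0 < T) {x : ℕ → ℝ → ℝ} {x₀ : ℝ → ℝ}
    (hx : ∀ n, Cadlag T (x n)) (hx₀ : Cadlag T x₀) (hs : SStarConv T x x₀)
    {𝒜 : Set (ℝ → ℝ)} (hA : ∀ A ∈ 𝒜, MemA T A) (hc : RelTauCompact T 𝒜) {δ : ℝ} (hδ : 0 < δ) :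
    ∃ N : ℕ, ∀ n ≥ N, ∀ A ∈ 𝒜, |intD T (fun u => x n u - x₀ u) A| ≤ δ := by
  rw [← eventually_atTop]
  by_contra hcon
  rw [not_eventually] at hcon
  obtain ⟨φ, hφ, hφ'⟩ := extraction_of_frequently_atTop hcon
  push Not at hφ'
  choose A hA' hlt using hφ'
  obtain ⟨ψ, hψ, A₀, hA₀, hτ⟩ := hc A hA'
  obtain ⟨χ, hχ, hS⟩ := hs (φ ∘ ψ) (hφ.comp hψ)
  have hτ' := hτ.comp hχ
  have hAm : ∀ k, MemA T (A (ψ (χ k))) := fun k => hA _ (hA' _)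
  have h1 := hS.tendsto_intD hT (fun k => hx _) hx₀ hAm hA₀ hτ'
  have h2 := (sConv_const hT hx₀).tendsto_intD hT (fun _ => hx₀) hx₀ hAm hA₀ hτ'
  have h3 := h1.sub h2
  rw [sub_self] at h3
  have h4 : ∀ᶠ k in atTop, |intD T (x (φ (ψ (χ k)))) (A (ψ (χ k))) -
      intD T x₀ (A (ψ (χ k)))| < δ := by
    have h5 := h3.abs
    rw [abs_zero] at h5
    exact h5.eventually (gt_mem_nhds hδ)
  obtain ⟨k, hk⟩ := h4.exists
  obtain ⟨P, N, h, -⟩ := (hAm k).exists_isDecomp hT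
  have h5 := hlt (ψ (χ k))
  rw [intD_sub hT h ((hx _).bddMeas hT) (hx₀.bddMeas hT)] at h5
  exact lt_asymm h5 hk

lemma MemA.zero (T : ℝ) : MemA T (fun _ => 0) :=
  ⟨continuousOn_const, by
    rw [BoundedVariationOn, eVariationOn.constant_on]
    · exact ENNReal.zero_ne_top
    · exact (subsingleton_singleton (a := (0:ℝ))).anti (by rintro _ ⟨t, -, rfl⟩; rfl), rfl⟩

lemma MemA.add {T : ℝ} {A B : ℝ → ℝ} (hA : MemA T A) (hB : MemA T B) :
    MemA T (fun t => A t + B t) :=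
  ⟨hA.1.add hB.1, ne_top_of_le_ne_top (ENNReal.add_ne_top.2 ⟨hA.2.1, hB.2.1⟩)
    (eVariationOn_add_le _ _ _), by simp [hA.2.2, hB.2.2]⟩

lemma MemA.const_mul {T : ℝ} {A : ℝ → ℝ} (hA : MemA T A) (c : ℝ) : MemA T (fun t => c * A t) :=
  ⟨hA.1.const_mul c, ne_top_of_le_ne_top (ENNReal.mul_ne_top ENNReal.ofReal_ne_top hA.2.1)
    (eVariationOn_const_mul_le _ _ _), by simp [hA.2.2]⟩

lemma MemA.sum {T : ℝ} (s : Finset ℕ) {A : ℕ → ℝ → ℝ} (hA : ∀ i ∈ s, MemA T (A i)) :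
    MemA T (fun t => ∑ i ∈ s, A i t) ∧ eVariationOn (fun t => ∑ i ∈ s, A i t) (Icc 0 T) ≤
      ∑ i ∈ s, eVariationOn (A i) (Icc 0 T) := by
  induction s using Finset.cons_induction with
  | empty =>
    refine ⟨by simpa using MemA.zero T, ?_⟩
    simp only [Finset.sum_empty, nonpos_iff_eq_zero]
    exact eVariationOn.constant_on
      ((subsingleton_singleton (a := (0:ℝ))).anti (by rintro _ ⟨t, -, rfl⟩; rfl))
  | cons a s ha ih =>
    obtain ⟨h1, h2⟩ := ih fun i hi => hA i (Finset.mem_cons_of_mem hi)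
    simp only [Finset.sum_cons]
    exact ⟨(hA a (Finset.mem_cons_self a s)).add h1,
      (eVariationOn_add_le _ _ _).trans (add_le_add_right h2 _)⟩

/-- The piecewise linear function rising from `0` at `u` to `1` at `u + h`. -/
def ramp (u h t : ℝ) : ℝ := max 0 (min 1 ((t - u) / h))

lemma ramp_nonneg (u h t : ℝ) : 0 ≤ ramp u h t := le_max_left _ _

lemma ramp_le_one (u h t : ℝ) : ramp u h t ≤ 1 := max_le zero_le_one (min_le_left _ _)

lemma ramp_anti {u u' h : ℝ} (hh : 0 < h) (hu : u ≤ u') (t : ℝ) : ramp u' h t ≤ ramp u h t := by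
  unfold ramp
  gcongr

lemma memA_ramp {T u h : ℝ} (hT : 0 < T) (hu : 0 ≤ u) (hh : 0 < h) :
    MemA T (ramp u h) ∧ eVariationOn (ramp u h) (Icc 0 T) ≤ 1 := by
  have hm : Monotone (ramp u h) := by
    intro s t hst
    unfold ramp
    gcongr
  have hv : eVariationOn (ramp u h) (Icc 0 T) ≤ 1 := by
    have h1 := (hm.monotoneOn (Icc 0 T)).eVariationOn_eq (left_mem_Icc.2 hT.le)
      (right_mem_Icc.2 hT.le)
    rw [inter_self] at h1
    rw [h1, ENNReal.ofReal_le_one]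
    linarith [ramp_nonneg u h 0, ramp_le_one u h T]
  refine ⟨⟨?_, ne_top_of_le_ne_top ENNReal.one_ne_top hv, ?_⟩, hv⟩
  · unfold ramp
    fun_prop
  · have : (0 - u) / h ≤ 0 := div_nonpos_of_nonpos_of_nonneg (by linarith) hh.le
    unfold ramp
    exact max_eq_left ((min_le_right _ _).trans this)

lemma isDecomp_ramp {T u h : ℝ} (hu : 0 ≤ u) (hh : 0 < h) (huh : u + h ≤ T) :
    IsDecomp T (ramp u h) (ENNReal.ofReal h⁻¹ • volume.restrict (Icc u (u + h))) 0 where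
  finP := Measure.smul_finite _ ENNReal.ofReal_ne_top
  finN := inferInstance
  suppP := by
    rw [Measure.smul_apply, Measure.restrict_apply measurableSet_Icc.compl]
    have : (Icc 0 T)ᶜ ∩ Icc u (u + h) = ∅ := by
      ext t
      simp only [mem_inter_iff, mem_compl_iff, mem_Icc, mem_empty_iff_false, iff_false]
      exact fun h1 => h1.1 ⟨hu.trans h1.2.1, h1.2.2.trans huh⟩
    simp [this]
  suppN := by simp
  sub t _ := by
    have h1 : Iic t ∩ Icc u (u + h) = Icc u (min t (u + h)) := by
      ext
      simp only [mem_inter_iff, mem_Iic, mem_Icc, le_min_iff]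
      tauto
    rw [measureReal_ennreal_smul_apply, measureReal_restrict_apply measurableSet_Iic, h1,
      Real.volume_real_Icc, ENNReal.toReal_ofReal (by positivity)]
    simp only [measureReal_zero, Pi.zero_apply, sub_zero, ramp]
    rw [mul_max_of_nonneg _ _ (by positivity), mul_zero, max_comm]
    congr 1
    rw [min_comm, ← min_sub_sub_right, mul_min_of_nonneg _ _ (by positivity)]
    congr 1
    · field_simp
      ring
    · field_simp

lemma tendsto_intD_ramp {T u : ℝ} (hT : 0 < T) {x : ℝ → ℝ} (hx : Cadlag T x) (hu : u ∈ Ico 0 T) :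
    Tendsto (fun h => intD T x (ramp u h)) (𝓝[>] 0) (𝓝 (x u)) := by
  rw [Metric.tendsto_nhds]
  intro ε hε
  have h1 := (hx.1 u hu).eventually (Metric.ball_mem_nhds _ (half_pos hε))
  obtain ⟨w, hw, hw'⟩ := (mem_nhdsGT_iff_exists_Ioo_subset).1 h1
  have hw0 : 0 < min (w - u) (T - u) := lt_min (sub_pos.2 hw) (sub_pos.2 hu.2)
  filter_upwards [Ioo_mem_nhdsGT hw0] with h hh
  have hd := isDecomp_ramp hu.1 hh.1 (T := T) (by linarith [hh.2.trans_le (min_le_right _ _)])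
  have := hd.finP
  set P := ENNReal.ofReal h⁻¹ • volume.restrict (Icc u (u + h)) with hP
  have hP1 : P.real univ = 1 := by
    rw [hP, measureReal_ennreal_smul_apply, measureReal_restrict_apply MeasurableSet.univ,
      univ_inter, Real.volume_real_Icc, ENNReal.toReal_ofReal (inv_nonneg.2 hh.1.le),
      add_sub_cancel_left, max_eq_left hh.1.le, inv_mul_cancel₀ hh.1.ne']
  have hxP := (hx.bddMeas hT).integrable hd.suppP
  have h2 : intD T x (ramp u h) - x u = ∫ t, (x t - x u) ∂P := by
    rw [hd.intD_eq hT (hx.bddMeas hT), integral_sub hxP (integrable_const _)]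
    simp [hP1]
  rw [Real.dist_eq, h2, ← Real.norm_eq_abs]
  refine (norm_integral_le_of_norm_le_const (C := ε / 2) ?_).trans_lt (by rw [hP1]; linarith)
  refine Measure.ae_smul_measure ?_ _
  filter_upwards [ae_restrict_mem measurableSet_Icc] with t ht
  rcases ht.1.eq_or_lt with h3 | h3
  · simp [← h3, (half_pos hε).le]
  · exact (hw' ⟨h3, ht.2.trans_lt (by linarith [hh.2.trans_le (min_le_left _ _)])⟩ : dist _ _ < _).le

/-- Integrals against relatively `τ`-compact sets of integrators converge uniformly. -/
def UnifIntConv (T : ℝ) (x : ℕ → ℝ → ℝ) (x₀ : ℝ → ℝ) : Prop :=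
  ∀ 𝒜 : Set (ℝ → ℝ), (∀ A ∈ 𝒜, MemA T A) → RelTauCompact T 𝒜 →
    ∀ δ > (0:ℝ), ∃ N : ℕ, ∀ n ≥ N, ∀ A ∈ 𝒜, |intD T (fun u => x n u - x₀ u) A| ≤ δ

lemma tauConv_const {T : ℝ} {A : ℝ → ℝ} (hA : MemA T A) : TauConv T (fun _ => A) A := by
  refine ⟨fun u hu => Eventually.of_forall fun _ _ _ => refl_mem_uniformity hu,
    (eVariationOn A (Icc 0 T)).toReal, fun _ => ?_⟩
  rw [ENNReal.ofReal_toReal hA.2.1]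

lemma TauConv.relTauCompact_range {T : ℝ} {B : ℕ → ℝ → ℝ} {B₀ : ℝ → ℝ} (hB : ∀ k, MemA T (B k))
    (hB₀ : MemA T B₀) (h : TauConv T B B₀) : RelTauCompact T (range B) := by
  intro A hA
  choose m hm using hA
  obtain rfl : (fun n => B (m n)) = A := funext hm
  by_cases hc : ∃ c, ∃ᶠ n in atTop, m n = c
  · obtain ⟨c, hc⟩ := hc
    obtain ⟨φ, hφ, hφ'⟩ := extraction_of_frequently_atTop hc
    refine ⟨φ, hφ, B c, hB c, ?_⟩
    simp only [hφ']
    exact tauConv_const (hB c)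
  · push Not at hc
    have hmt : Tendsto m atTop atTop := by
      rw [tendsto_atTop]
      intro b
      filter_upwards [(eventually_all_finset (Finset.range b)).2 fun c _ => hc c] with n hn
      by_contra hlt
      exact hn (m n) (Finset.mem_range.2 (not_le.1 hlt)) rfl
    obtain ⟨φ, hφ, hφ'⟩ := strictMono_subseq_of_tendsto_atTop hmt
    exact ⟨φ, hφ, B₀, hB₀, h.comp hφ'⟩

lemma UnifIntConv.tendsto_intD {T : ℝ} (hT : 0 < T) {x : ℕ → ℝ → ℝ} {x₀ : ℝ → ℝ}
    (hx : ∀ n, Cadlag T (x n)) (hx₀ : Cadlag T x₀) (H : UnifIntConv T x x₀) {B : ℕ → ℝ → ℝ}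
    {B₀ : ℝ → ℝ} (hB : ∀ k, MemA T (B k)) (hB₀ : MemA T B₀) (hτ : TauConv T B B₀) {φ : ℕ → ℕ}
    (hφ : StrictMono φ) : Tendsto (fun k => intD T (x (φ k)) (B k)) atTop (𝓝 (intD T x₀ B₀)) := by
  have h1 := (sConv_const hT hx₀).tendsto_intD hT (fun _ => hx₀) hx₀ hB hB₀ hτ
  have h2 : Tendsto (fun k => intD T (fun u => x (φ k) u - x₀ u) (B k)) atTop (𝓝 0) := by
    rw [Metric.tendsto_atTop]
    intro ε hε
    obtain ⟨N, hN⟩ := H (range B) (by rintro _ ⟨k, rfl⟩; exact hB k)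
      (hτ.relTauCompact_range hB hB₀) (ε / 2) (half_pos hε)
    refine ⟨N, fun k hk => ?_⟩
    rw [Real.dist_eq, sub_zero]
    linarith [hN (φ k) (hk.trans (hφ.le_apply)) _ ⟨k, rfl⟩]
  have h3 := h1.add h2
  rw [add_zero] at h3
  refine h3.congr fun k => ?_
  obtain ⟨P, N, h, -⟩ := (hB k).exists_isDecomp hT
  rw [intD_sub hT h ((hx _).bddMeas hT) (hx₀.bddMeas hT)]
  ring

lemma UnifIntConv.eventually_intD_lt {T : ℝ} (hT : 0 < T) {x : ℕ → ℝ → ℝ} {x₀ : ℝ → ℝ}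
    (hx : ∀ n, Cadlag T (x n)) (hx₀ : Cadlag T x₀) (H : UnifIntConv T x x₀) {c : ℝ} (hc : 0 < c) :
    ∃ k : ℕ, ∀ᶠ n in atTop, ∀ A, MemA T A → (∀ t ∈ Icc (0:ℝ) T, |A t| ≤ 1 / ((k:ℝ) + 1)) →
      eVariationOn A (Icc 0 T) ≤ 2 → intD T (x n) A < c := by
  by_contra! hcon
  obtain ⟨φ, hφ, hφ'⟩ := extraction_forall_of_frequently fun k => not_eventually.1 (hcon k)
  push Not at hφ'
  choose B hB hB1 hB2 hBc using hφ'
  have hτ : TauConv T B (fun _ => 0) := by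
    refine ⟨?_, 2, fun n => (hB2 n).trans (by simp)⟩
    rw [Metric.tendstoUniformlyOn_iff]
    intro ε hε
    filter_upwards [(tendsto_one_div_add_atTop_nhds_zero_nat (𝕜 := ℝ)).eventually
      (gt_mem_nhds hε)] with k hk t ht
    rw [dist_comm, Real.dist_eq, sub_zero]
    exact (hB1 k t ht).trans_lt hk
  have h1 := H.tendsto_intD hT hx hx₀ hB (MemA.zero T) hτ hφ
  rw [intD_zero hT (hx₀.bddMeas hT)] at h1
  exact absurd (ge_of_tendsto' h1 hBc) (not_le.2 hc)

lemma UnifIntConv.eventually_bounded {T : ℝ} (hT : 0 < T) {x : ℕ → ℝ → ℝ} {x₀ : ℝ → ℝ}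
    (hx : ∀ n, Cadlag T (x n)) (hx₀ : Cadlag T x₀) (H : UnifIntConv T x x₀)
    (hxT : Tendsto (fun n => x n T) atTop (𝓝 (x₀ T))) :
    ∃ B, ∀ᶠ n in atTop, ∀ t ∈ Icc (0:ℝ) T, |x n t| ≤ B := by
  obtain ⟨k, hk⟩ := H.eventually_intD_lt hT hx hx₀ one_pos
  refine ⟨max ((k:ℝ) + 1) (|x₀ T| + 1), ?_⟩
  have hxT' := hxT.abs.eventually (gt_mem_nhds (lt_add_one |x₀ T|))
  filter_upwards [hk, hxT'] with n hn hnT t ht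
  rcases ht.2.eq_or_lt with h | h
  · rw [h]
    exact hnT.le.trans (le_max_right _ _)
  refine le_trans ?_ (le_max_left _ _)
  have hk0 : (0:ℝ) < (k:ℝ) + 1 := by positivity
  have hk1 : 1 / ((k:ℝ) + 1) ≤ 1 := by
    rw [div_le_one hk0]
    linarith [Nat.cast_nonneg (α := ℝ) k]
  have key : ∀ σ : ℝ, |σ| = 1 → σ * x n t ≤ (k:ℝ) + 1 := by
    intro σ hσ
    have h1 := (tendsto_intD_ramp hT (hx n) ⟨ht.1, h⟩).const_mul (σ / ((k:ℝ) + 1))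
    have hσk : |σ / ((k:ℝ) + 1)| = 1 / ((k:ℝ) + 1) := by rw [abs_div, hσ, abs_of_pos hk0]
    have h2 : σ / ((k:ℝ) + 1) * x n t ≤ 1 := by
      refine le_of_tendsto h1 ?_
      filter_upwards [self_mem_nhdsWithin] with h (hh : 0 < h)
      obtain ⟨hA, hv⟩ := memA_ramp hT ht.1 hh
      obtain ⟨P, N, hd, -⟩ := hA.exists_isDecomp hT
      rw [← hd.intD_const_mul hT ((hx n).bddMeas hT)]
      refine (hn _ (hA.const_mul _) (fun s _ => ?_) ?_).le
      · rw [abs_mul, hσk, abs_of_nonneg (ramp_nonneg _ _ _)]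
        exact mul_le_of_le_one_right (by positivity) (ramp_le_one _ _ _)
      · refine (eVariationOn_const_mul_le _ _ _).trans ?_
        rw [hσk]
        calc _ ≤ (1:ENNReal) * 1 := mul_le_mul' (ENNReal.ofReal_le_one.2 hk1) hv
          _ ≤ 2 := by norm_num
    rw [div_mul_eq_mul_div, div_le_one hk0] at h2
    exact h2
  rw [abs_le]
  constructor
  · linarith [key (-1) (by simp)]
  · linarith [key 1 (by simp)]

lemma abs_signed_sum_ramp_sub_le {u σ : ℕ → ℝ} {K : ℕ} {h c : ℝ} (hh : 0 < h) (hc : 0 ≤ c)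
    (hσ : ∀ i, |σ i| = c) (hu : ∀ i < K, u i ≤ u (i + 1)) (t : ℝ) :
    |∑ i ∈ Finset.range K, σ i * (ramp (u (i + 1)) h t + -1 * ramp (u i) h t)| ≤ c := by
  calc _ ≤ ∑ i ∈ Finset.range K, |σ i * (ramp (u (i + 1)) h t + -1 * ramp (u i) h t)| :=
        Finset.abs_sum_le_sum_abs _ _
    _ = ∑ i ∈ Finset.range K, c * (ramp (u i) h t - ramp (u (i + 1)) h t) := by
        refine Finset.sum_congr rfl fun i hi => ?_
        have := ramp_anti hh (hu i (Finset.mem_range.1 hi)) t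
        rw [abs_mul, hσ, abs_of_nonpos (by linarith)]
        ring
    _ = c * (ramp (u 0) h t - ramp (u K) h t) := by
        rw [← Finset.mul_sum, Finset.sum_range_sub']
    _ ≤ c := mul_le_of_le_one_right hc (by linarith [ramp_nonneg (u K) h t, ramp_le_one (u 0) h t])

lemma UnifIntConv.eventually_not_incrChain {T : ℝ} (hT : 0 < T) {x : ℕ → ℝ → ℝ} {x₀ : ℝ → ℝ}
    (hx : ∀ n, Cadlag T (x n)) (hx₀ : Cadlag T x₀) (H : UnifIntConv T x x₀) {η : ℝ} (hη : 0 < η) :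
    ∃ K, ∀ᶠ n in atTop, ¬ IncrChain T (x n) η K 0 := by
  obtain ⟨k, hk⟩ := H.eventually_intD_lt hT hx hx₀ hη
  refine ⟨k + 1 + 1, ?_⟩
  filter_upwards [hk] with n hn
  rintro ⟨u, -, hu, hu'⟩
  have hu1 : ∀ i ≤ k + 1, u i ∈ Ico 0 T := fun i hi =>
    ⟨(hu i (by omega)).1, (hu' i (by omega)).1.trans_le (hu (i + 1) (by omega)).2⟩
  have hk0 : (0:ℝ) < (k:ℝ) + 1 := by positivity
  set c : ℝ := 1 / ((k:ℝ) + 1) with hc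
  have hc0 : 0 < c := by positivity
  set σ : ℕ → ℝ := fun i => if 0 ≤ x n (u (i + 1)) - x n (u i) then c else -c with hσdef
  have hσ : ∀ i, |σ i| = c := by
    intro i
    simp only [hσdef]
    split_ifs <;> simp [abs_of_pos hc0]
  have hσx : ∀ i, σ i * (x n (u (i + 1)) + -1 * x n (u i)) = c * |x n (u (i + 1)) - x n (u i)| := by
    intro i
    simp only [hσdef]
    split_ifs with h
    · rw [abs_of_nonneg h]
      ring
    · rw [abs_of_neg (not_le.1 h)]
      ring
  have h1 : Tendsto (fun h => ∑ i ∈ Finset.range (k + 1), σ i *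
      (intD T (x n) (ramp (u (i + 1)) h) + -1 * intD T (x n) (ramp (u i) h))) (𝓝[>] 0)
      (𝓝 (∑ i ∈ Finset.range (k + 1), σ i * (x n (u (i + 1)) + -1 * x n (u i)))) := by
    refine tendsto_finsetSum _ fun i hi => Tendsto.const_mul _ (Tendsto.add ?_ ?_)
    · exact tendsto_intD_ramp hT (hx n) (hu1 _ (Finset.mem_range.1 hi))
    · exact (tendsto_intD_ramp hT (hx n) (hu1 _ (Finset.mem_range.1 hi).le)).const_mul _
  have h2 : ∑ i ∈ Finset.range (k + 1), σ i * (x n (u (i + 1)) + -1 * x n (u i)) ≤ η := by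
    refine le_of_tendsto h1 ?_
    filter_upwards [self_mem_nhdsWithin] with h (hh : 0 < h)
    have hxb := (hx n).bddMeas hT
    have hr : ∀ i ≤ k + 1, MemA T (ramp (u i) h) ∧ eVariationOn (ramp (u i) h) (Icc 0 T) ≤ 1 :=
      fun i hi => memA_ramp hT (hu1 i hi).1 hh
    have hterm : ∀ i ∈ Finset.range (k + 1),
        MemA T (fun t => σ i * (ramp (u (i + 1)) h t + -1 * ramp (u i) h t)) := fun i hi =>
      ((hr _ (Finset.mem_range.1 hi)).1.add
        ((hr _ (Finset.mem_range.1 hi).le).1.const_mul (-1))).const_mul _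
    have hterm_int : ∀ i ∈ Finset.range (k + 1),
        intD T (x n) (fun t => σ i * (ramp (u (i + 1)) h t + -1 * ramp (u i) h t)) =
          σ i * (intD T (x n) (ramp (u (i + 1)) h) + -1 * intD T (x n) (ramp (u i) h)) := by
      intro i hi
      obtain ⟨P, N, hd, -⟩ := (hr _ (Finset.mem_range.1 hi)).1.exists_isDecomp hT
      obtain ⟨P', N', hd', -⟩ := (hr _ (Finset.mem_range.1 hi).le).1.exists_isDecomp hT
      rw [(hd.add (hd'.const_mul (-1))).intD_const_mul hT hxb, hd.intD_add hT (hd'.const_mul (-1)) hxb,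
        hd'.intD_const_mul hT hxb]
    rw [← Finset.sum_congr rfl hterm_int, ← (IsDecomp.sum hT (Finset.range (k + 1)) fun i hi =>
      let ⟨P, N, hd, _⟩ := (hterm i hi).exists_isDecomp hT
      ⟨P, N, hd⟩).2 _ hxb]
    obtain ⟨hA, hv⟩ := MemA.sum _ hterm
    refine (hn _ hA (fun t _ => abs_signed_sum_ramp_sub_le hh hc0.le hσ
      (fun i hi => (hu' i (by omega)).1.le) t) (hv.trans ?_)).le
    calc _ ≤ ∑ i ∈ Finset.range (k + 1), ENNReal.ofReal c * 2 := by
          refine Finset.sum_le_sum fun i hi => (eVariationOn_const_mul_le _ _ _).trans ?_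
          rw [hσ]
          gcongr
          refine (eVariationOn_add_le _ _ _).trans ?_
          rw [← one_add_one_eq_two]
          refine add_le_add (hr _ (Finset.mem_range.1 hi)).2 ?_
          refine (eVariationOn_const_mul_le _ _ _).trans ?_
          simpa using (hr _ (Finset.mem_range.1 hi).le).2
      _ = 2 := by
          have h3 : ((k + 1 : ℕ) : ENNReal) = ENNReal.ofReal ((k:ℝ) + 1) := by
            rw [← ENNReal.ofReal_natCast]
            push_cast
            rfl
          rw [Finset.sum_const, Finset.card_range, nsmul_eq_mul, ← mul_assoc, h3,
            ← ENNReal.ofReal_mul hk0.le, hc, mul_one_div_cancel hk0.ne', ENNReal.ofReal_one, one_mul]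
  have h3 : ∑ i ∈ Finset.range (k + 1), c * η < ∑ i ∈ Finset.range (k + 1),
      σ i * (x n (u (i + 1)) + -1 * x n (u i)) := by
    refine Finset.sum_lt_sum_of_nonempty ⟨0, by simp⟩ fun i hi => ?_
    rw [hσx]
    have := (hu' i (by have := Finset.mem_range.1 hi; omega)).2
    gcongr
  have h4 : ∑ i ∈ Finset.range (k + 1), c * η = η := by
    rw [Finset.sum_const, Finset.card_range, nsmul_eq_mul, hc]
    push_cast
    field_simp
  linarith

lemma UnifIntConv.eventually_stepApprox {T : ℝ} (hT : 0 < T) {x : ℕ → ℝ → ℝ} {x₀ : ℝ → ℝ}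
    (hx : ∀ n, Cadlag T (x n)) (hx₀ : Cadlag T x₀) (H : UnifIntConv T x x₀)
    (hxT : Tendsto (fun n => x n T) atTop (𝓝 (x₀ T))) {ε : ℝ} (hε : 0 < ε) :
    ∃ B d, ∀ᶠ n in atTop, StepApprox T (x n) ε B d 0 := by
  obtain ⟨B, hB⟩ := H.eventually_bounded hT hx hx₀ hxT
  obtain ⟨K, hK⟩ := H.eventually_not_incrChain hT hx hx₀ (half_pos hε)
  refine ⟨B, 2 * K + 1, ?_⟩
  filter_upwards [hB, hK] with n hBn hKn
  exact stepApprox_of_not_incrChain (hx n).1 hBn (half_pos hε) (half_lt_self hε) K 0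
    ⟨le_rfl, hT.le⟩ hKn

/-- Along a subsequence the step approximations of all orders have convergent parameters. -/
lemma exists_subseq_stepFun_tendsto {T : ℝ} (hT : 0 < T) {y : ℕ → ℝ → ℝ} {ε : ℕ → ℝ}
    (hy : ∀ m, ∃ B d, ∀ᶠ n in atTop, StepApprox T (y n) (ε m) B d 0) :
    ∃ ψ : ℕ → ℕ, StrictMono ψ ∧ ∀ m, ∃ d, ∃ (p : ℕ → Fin d → ℝ × ℝ) (p₀ : Fin d → ℝ × ℝ),
      (∀ k i, (p k i).2 ∈ Icc 0 T) ∧ (∀ i, (p₀ i).2 ∈ Icc 0 T) ∧ Tendsto p atTop (𝓝 p₀) ∧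
      ∀ᶠ k in atTop, ∀ t ∈ Icc 0 T, |y (ψ k) t - stepFun (p k) t| ≤ ε m := by
  choose B d hBd using hy
  let S : (m : ℕ) → Set (Fin (d m) → ℝ × ℝ) := fun m =>
    Set.pi univ fun _ => Icc (-|B m|) |B m| ×ˢ Icc 0 T
  have hS : IsCompact (Set.pi univ S) := isCompact_univ_pi fun m =>
    isCompact_univ_pi fun _ => isCompact_Icc.prod isCompact_Icc
  have hq : ∀ n m, ∃ q ∈ S m, StepApprox T (y n) (ε m) (B m) (d m) 0 →
      ∀ t ∈ Icc 0 T, |y n t - stepFun q t| ≤ ε m := by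
    intro n m
    by_cases h : StepApprox T (y n) (ε m) (B m) (d m) 0
    · obtain ⟨p, hp, hp'⟩ := h
      exact ⟨p, fun i _ => ⟨abs_le.1 ((hp i).1.trans (le_abs_self _)), (hp i).2⟩, fun _ => hp'⟩
    · exact ⟨fun _ => (0, 0), fun i _ => ⟨by simp, le_rfl, hT.le⟩, fun h' => absurd h' h⟩
  choose q hqS hq using hq
  obtain ⟨a, ha, ψ, hψ, hlim⟩ := hS.tendsto_subseq (x := q) fun n m _ => hqS n m
  refine ⟨ψ, hψ, fun m => ⟨d m, fun k => q (ψ k) m, a m, fun k i => ?_, fun i => ?_, ?_, ?_⟩⟩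
  · exact (hqS (ψ k) m i trivial).2
  · exact (ha m trivial i trivial).2
  · exact tendsto_pi_nhds.1 hlim m
  · filter_upwards [hψ.tendsto_atTop.eventually (hBd m)] with k hk using hq _ _ hk

lemma tendsto_intD_stepFun {T : ℝ} (hT : 0 < T) {d : ℕ} {p : ℕ → Fin d → ℝ × ℝ}
    {p₀ : Fin d → ℝ × ℝ} (hp : ∀ k i, (p k i).2 ∈ Icc 0 T) (hp₀ : ∀ i, (p₀ i).2 ∈ Icc 0 T)
    (hlim : Tendsto p atTop (𝓝 p₀)) {f : ℝ → ℝ} (hf : Continuous f) :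
    Tendsto (fun k => intD T f (stepFun (p k))) atTop (𝓝 (intD T f (stepFun p₀))) := by
  have hfb : BddMeas T f := hf.continuousOn.bddMeas
  rw [intD_stepFun hT hp₀ hfb]
  simp_rw [fun k => intD_stepFun hT (hp k) hfb]
  refine tendsto_finsetSum _ fun i _ => ?_
  have hi := tendsto_pi_nhds.1 hlim i
  exact hi.fst_nhds.mul ((hf.tendsto _).comp hi.snd_nhds)

/-- The limit of the step approximations approximates the limit function. -/
lemma abs_sub_le_of_weak_tendsto {T : ℝ} (hT : 0 < T) {y v : ℕ → ℝ → ℝ} {x₀ v₀ : ℝ → ℝ} {ε : ℝ}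
    (hy : ∀ k, Cadlag T (y k)) (hx₀ : Cadlag T x₀) (hv : ∀ k, MemV T (v k)) (hv₀ : MemV T v₀)
    (hyT : Tendsto (fun k => y k T) atTop (𝓝 (x₀ T)))
    (hyA : ∀ A, MemA T A → Tendsto (fun k => intD T (y k) A) atTop (𝓝 (intD T x₀ A)))
    (hw : ∀ f, Continuous f → Tendsto (fun k => intD T f (v k)) atTop (𝓝 (intD T f v₀)))
    (hyv : ∀ᶠ k in atTop, ∀ t ∈ Icc (0:ℝ) T, |y k t - v k t| ≤ ε) :
    ∀ t ∈ Icc (0:ℝ) T, |x₀ t - v₀ t| ≤ ε := by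
  intro t ht
  rcases ht.2.eq_or_lt with h | h
  · rw [h]
    refine le_of_tendsto (hyT.sub (tendsto_apply_of_weak_tendsto hT hv hv₀ hw)).abs ?_
    filter_upwards [hyv] with k hk using hk T ⟨hT.le, le_rfl⟩
  · have h1 := ((tendsto_intD_ramp hT hx₀ ⟨ht.1, h⟩).sub
      (tendsto_intD_ramp hT hv₀.1 ⟨ht.1, h⟩)).abs
    refine le_of_tendsto h1 ?_
    filter_upwards [self_mem_nhdsWithin] with h (hh : 0 < h)
    obtain ⟨hA, hvar⟩ := memA_ramp hT ht.1 hh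
    obtain ⟨P, N, hd, -⟩ := hA.exists_isDecomp hT
    have h2 := tendsto_intD_of_weak_tendsto hT hv hv₀ hw (fun _ => hA) hA (tauConv_const hA).1
    refine le_of_tendsto ((hyA _ hA).sub h2).abs ?_
    filter_upwards [hyv] with k hk
    have hyb := (hy k).bddMeas hT
    have hvb := (hv k).1.bddMeas hT
    rw [← intD_sub hT hd hyb hvb, ← mul_one ε]
    exact hA.abs_intD_le hT (hyb.sub hvb) hk zero_le_one (by simpa using hvar)

lemma UnifIntConv.sStarConv {T : ℝ} (hT : 0 < T) {x : ℕ → ℝ → ℝ} {x₀ : ℝ → ℝ}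
    (hx : ∀ n, Cadlag T (x n)) (hx₀ : Cadlag T x₀) (H : UnifIntConv T x x₀)
    (hxT : Tendsto (fun n => x n T) atTop (𝓝 (x₀ T))) : SStarConv T x x₀ := by
  intro φ hφ
  obtain ⟨ψ, hψ, hp⟩ := exists_subseq_stepFun_tendsto hT (y := fun n => x (φ n))
    (ε := fun m => 1 / ((m:ℝ) + 1)) fun m => by
      obtain ⟨B, d, h⟩ := H.eventually_stepApprox hT hx hx₀ hxT
        (Nat.one_div_pos_of_nat (n := m) (α := ℝ))
      exact ⟨B, d, hφ.tendsto_atTop.eventually h⟩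
  refine ⟨ψ, hψ, fun ε hε => ?_⟩
  obtain ⟨m, hm⟩ := exists_nat_one_div_lt hε
  obtain ⟨d, p, p₀, hpT, hp₀T, hlim, happ⟩ := hp m
  have hφψ : StrictMono fun k => φ (ψ k) := hφ.comp hψ
  have hw : ∀ f, Continuous f → Tendsto (fun k => intD T f (stepFun (p k))) atTop
      (𝓝 (intD T f (stepFun p₀))) := fun f hf => tendsto_intD_stepFun hT hpT hp₀T hlim hf
  have happ' : ∀ᶠ k in atTop, ∀ t ∈ Icc 0 T, |x (φ (ψ k)) t - stepFun (p k) t| ≤ ε := by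
    filter_upwards [happ] with k hk t ht using (hk t ht).trans hm.le
  have hv : ∀ k, ∃ v, MemV T v ∧ (∀ t ∈ Icc 0 T, |x (φ (ψ k)) t - v t| ≤ ε) ∧
      ((∀ t ∈ Icc 0 T, |x (φ (ψ k)) t - stepFun (p k) t| ≤ ε) → v = stepFun (p k)) := by
    intro k
    by_cases h : ∀ t ∈ Icc 0 T, |x (φ (ψ k)) t - stepFun (p k) t| ≤ ε
    · exact ⟨_, memV_stepFun _, h, fun _ => rfl⟩
    · obtain ⟨B, d, q, -, hq⟩ := (hx (φ (ψ k))).exists_stepApprox hT hε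
      exact ⟨_, memV_stepFun q, hq, fun h' => absurd h' h⟩
  choose v hvV hvx hveq using hv
  refine ⟨v, stepFun p₀, hvV, memV_stepFun p₀, hvx, ?_, fun f hf => ?_⟩
  · exact abs_sub_le_of_weak_tendsto hT (fun k => hx (φ (ψ k))) hx₀ (fun k => memV_stepFun (p k))
      (memV_stepFun p₀) (hxT.comp hφψ.tendsto_atTop)
      (fun A hA => H.tendsto_intD hT hx hx₀ (fun _ => hA) hA (tauConv_const hA) hφψ) hw happ'
  · refine (hw f hf).congr' ?_
    filter_upwards [happ'] with k hk
    rw [hveq k hk]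

/-- Corollary 3.4. -/
theorem stmt3 (T : ℝ) (hT : 0 < T) (x : ℕ → ℝ → ℝ) (x₀ : ℝ → ℝ)
    (hx : ∀ n, Cadlag T (x n)) (hx₀ : Cadlag T x₀) :
    SStarConv T x x₀ ↔
      (Filter.Tendsto (fun n => x n T) Filter.atTop (nhds (x₀ T)) ∧
        ∀ 𝒜 : Set (ℝ → ℝ), (∀ A ∈ 𝒜, MemA T A) → RelTauCompact T 𝒜 →
          ∀ δ > (0:ℝ), ∃ N : ℕ, ∀ n ≥ N, ∀ A ∈ 𝒜,
            |intD T (fun u => x n u - x₀ u) A| ≤ δ) := by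
  exact ⟨fun h => ⟨h.tendsto_apply hT, fun _ hA hc _ hδ => h.uniform_intD hT hx hx₀ hA hc hδ⟩,
    fun h => UnifIntConv.sStarConv hT hx hx₀ h.2 h.1⟩

end
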